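/- arXiv:1503.06315 — 9 statements merged into one kernel-verified Lean document; each statement's English description precedes it below -/
import Mathlib

section
/- For every n ≥ 1, δ_n ≠ 0 and |δ_n| ≥ γ |b_n| |δ_{n−1}|. -/
/-- for the recursively defined determinants
`δ_0 = 1`, `δ_1 = b_1`, `δ_n = b_n δ_{n-1} - a_n c_{n-1} δ_{n-2}`,
one has `δ_n ≠ 0` and `|δ_n| ≥ γ |b_n| |δ_{n-1}|` for every `n ≥ 1`. -/
theorem statement2 (δ : ℝ) (hδ0 : 0 < δ) (hδ1 : δ < 1 / 2)
    (a b c : ℕ → ℝ)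
    (hb : ∀ n, 1 ≤ n → b n ≠ 0)
    (ha : ∀ n, 2 ≤ n → |a n| ≤ δ * |b n|)
    (hc : ∀ n, 1 ≤ n → |c n| ≤ δ * |b n|)
    (d : ℕ → ℝ)
    (hd0 : d 0 = 1) (hd1 : d 1 = b 1)
    (hd : ∀ n : ℕ, d (n + 2) = b (n + 2) * d (n + 1) - a (n + 2) * c (n + 1) * d n)
    (γ : ℝ) (hγ : γ = 1 / 2 + Real.sqrt (1 / 4 - δ ^ 2)) :
    ∀ n, 1 ≤ n → d n ≠ 0 ∧ γ * |b n| * |d (n - 1)| ≤ |d n| := by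
  have hδsq : δ ^ 2 < 1 / 4 := by nlinarith
  have hsq : Real.sqrt (1 / 4 - δ ^ 2) ^ 2 = 1 / 4 - δ ^ 2 := Real.sq_sqrt (by linarith)
  have hsnn : 0 ≤ Real.sqrt (1 / 4 - δ ^ 2) := Real.sqrt_nonneg _
  have hγ0 : 0 < γ := by linarith
  have hγq : δ ^ 2 = (1 - γ) * γ := by rw [hγ]; linarith
  have hγ1 : 0 ≤ 1 - γ := by nlinarith
  have key : ∀ n, d (n + 1) ≠ 0 ∧ γ * |b (n + 1)| * |d n| ≤ |d (n + 1)| := by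
    intro n
    induction n with
    | zero =>
      refine ⟨by simpa [hd1] using hb 1 le_rfl, ?_⟩
      simp only [zero_add, hd0, hd1, abs_one, mul_one]
      nlinarith [abs_nonneg (b 1)]
    | succ k ih =>
      obtain ⟨hne, hle⟩ := ih
      have hac : |a (k + 2)| * |c (k + 1)| ≤ δ * |b (k + 2)| * (δ * |b (k + 1)|) :=
        mul_le_mul (ha _ (by omega)) (hc _ (by omega)) (abs_nonneg _) (by positivity)
      have hprod : |a (k + 2) * c (k + 1) * d k| ≤ |b (k + 2)| * ((1 - γ) * |d (k + 1)|) :=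
        calc |a (k + 2) * c (k + 1) * d k| = |a (k + 2)| * |c (k + 1)| * |d k| := by
              rw [abs_mul, abs_mul]
          _ ≤ δ * |b (k + 2)| * (δ * |b (k + 1)|) * |d k| := by gcongr
          _ = δ ^ 2 * (|b (k + 2)| * |b (k + 1)| * |d k|) := by ring
          _ = |b (k + 2)| * ((1 - γ) * (γ * |b (k + 1)| * |d k|)) := by rw [hγq]; ring
          _ ≤ |b (k + 2)| * ((1 - γ) * |d (k + 1)|) := by gcongr
      have hlow : γ * |b (k + 2)| * |d (k + 1)| ≤ |d (k + 2)| := by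
        have htri := abs_sub_abs_le_abs_sub (b (k + 2) * d (k + 1)) (a (k + 2) * c (k + 1) * d k)
        rw [← hd k, abs_mul (b (k + 2))] at htri
        linarith
      have hpos : 0 < γ * |b (k + 2)| * |d (k + 1)| :=
        mul_pos (mul_pos hγ0 (abs_pos.mpr (hb _ (by omega)))) (abs_pos.mpr hne)
      exact ⟨abs_pos.mp (hpos.trans_le hlow), hlow⟩
  intro n hn
  obtain ⟨k, rfl⟩ := Nat.exists_eq_add_of_le' hn
  exact key k
end

section
/- For every k ≥ 0, |z_k| ≤ Σ_{l=0}^{k} θ^l (|b_{k+1}|/|b_{k−l+1}|) |y_{k−l}|. -/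
/-- If `|a n| ≤ δ |b n|`, `|c n| ≤ δ |b n|` and `γ (1 - γ) = δ ^ 2`, the leading minors `d n` of the
tridiagonal matrix grow at least like `γ |b n|` from one step to the next. -/
lemma mul_abs_le_abs_succ {δ γ : ℝ} (hδ : 0 ≤ δ) (hγ1 : γ ≤ 1)
    (hγδ : γ * (1 - γ) = δ ^ 2) {a b c d : ℕ → ℝ}
    (ha : ∀ n, 2 ≤ n → |a n| ≤ δ * |b n|) (hc : ∀ n, 1 ≤ n → |c n| ≤ δ * |b n|)
    (hd0 : d 0 = 1) (hd1 : d 1 = b 1)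
    (hd : ∀ n : ℕ, d (n + 2) = b (n + 2) * d (n + 1) - a (n + 2) * c (n + 1) * d n) (n : ℕ) :
    γ * (|b (n + 1)| * |d n|) ≤ |d (n + 1)| := by
  induction n with
  | zero =>
    simpa [hd0, hd1] using mul_le_of_le_one_left (abs_nonneg (b 1)) hγ1
  | succ n ih =>
    have hac : |a (n + 2) * c (n + 1) * d n| ≤
        δ * |b (n + 2)| * (δ * |b (n + 1)|) * |d n| := by
      rw [abs_mul, abs_mul]
      gcongr
      · exact ha _ (by omega)
      · exact hc _ (by omega)
    have hsub : |b (n + 2)| * |d (n + 1)| - |a (n + 2) * c (n + 1) * d n| ≤ |d (n + 2)| := by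
      rw [hd n, ← abs_mul]
      exact abs_sub_abs_le_abs_sub _ _
    have hstep : (1 - γ) * |b (n + 2)| * (γ * (|b (n + 1)| * |d n|)) ≤
        (1 - γ) * |b (n + 2)| * |d (n + 1)| :=
      mul_le_mul_of_nonneg_left ih (mul_nonneg (by linarith) (abs_nonneg _))
    have hsq : δ * |b (n + 2)| * (δ * |b (n + 1)|) * |d n| =
        (1 - γ) * |b (n + 2)| * (γ * (|b (n + 1)| * |d n|)) := by
      linear_combination (-|b (n + 2)| * |b (n + 1)| * |d n|) * hγδ
    change γ * (|b (n + 2)| * |d (n + 1)|) ≤ |d (n + 2)|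
    linarith

/-- A product of `l` consecutive off-diagonal entries, compared with the growth of the minors. -/
lemma abs_prod_mul_le_pow_mul {δ γ : ℝ} (hδ : 0 ≤ δ) (hγ0 : 0 ≤ γ) {a b d : ℕ → ℝ}
    (ha : ∀ n, 2 ≤ n → |a n| ≤ δ * |b n|)
    (hd : ∀ n, γ * (|b (n + 1)| * |d n|) ≤ |d (n + 1)|) {k l : ℕ} (hl : l ≤ k) :
    |∏ i ∈ Finset.range l, a (k + 1 - i)| * |d (k - l)| * γ ^ l * |b (k - l + 1)| ≤
      δ ^ l * |b (k + 1)| * |d k| := by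
  induction l with
  | zero => simp [mul_comm]
  | succ l ih =>
    obtain ⟨m, rfl⟩ := Nat.exists_eq_add_of_le' hl
    have ih := ih (by omega)
    rw [show m + (l + 1) - l = m + 1 by omega] at ih
    rw [Finset.prod_range_succ, abs_mul, show m + (l + 1) - (l + 1) = m by omega,
      show m + (l + 1) + 1 - l = m + 2 by omega]
    set P := |∏ i ∈ Finset.range l, a (m + (l + 1) + 1 - i)|
    have hP : 0 ≤ P := abs_nonneg _
    calc P * |a (m + 2)| * |d m| * γ ^ (l + 1) * |b (m + 1)|
        = P * γ ^ l * (|a (m + 2)| * (γ * (|b (m + 1)| * |d m|))) := by ring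
      _ ≤ P * γ ^ l * (δ * |b (m + 2)| * |d (m + 1)|) := by
          gcongr
          · exact ha _ (by omega)
          · exact hd m
      _ = δ * (P * |d (m + 1)| * γ ^ l * |b (m + 1 + 1)|) := by ring
      _ ≤ δ * (δ ^ l * |b (m + (l + 1) + 1)| * |d (m + (l + 1))|) := by gcongr
      _ = _ := by ring

/-- for `z = L⁻¹ y` given by `z_0 = y_0` and
`z_k = y_k + Σ_{l=1}^{k} (−1)^l a_{k−l+2}⋯a_{k+1} (δ_{k−l}/δ_k) y_{k−l}` (`k ≥ 1`),
one has `|z_k| ≤ Σ_{l=0}^{k} θ^l (|b_{k+1}|/|b_{k−l+1}|) |y_{k−l}|` for every `k ≥ 0`. -/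
theorem statement3 (δ : ℝ) (hδ0 : 0 < δ) (hδ1 : δ < 1 / 2)
    (a b c : ℕ → ℝ)
    (hb : ∀ n, 1 ≤ n → b n ≠ 0)
    (ha : ∀ n, 2 ≤ n → |a n| ≤ δ * |b n|)
    (hc : ∀ n, 1 ≤ n → |c n| ≤ δ * |b n|)
    (d : ℕ → ℝ)
    (hd0 : d 0 = 1) (hd1 : d 1 = b 1)
    (hd : ∀ n : ℕ, d (n + 2) = b (n + 2) * d (n + 1) - a (n + 2) * c (n + 1) * d n)
    (γ θ : ℝ) (hγ : γ = 1 / 2 + Real.sqrt (1 / 4 - δ ^ 2)) (hθ : θ = δ / γ)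
    (y z : ℕ → ℝ)
    (hz0 : z 0 = y 0)
    (hzk : ∀ k, 1 ≤ k → z k = y k + ∑ l ∈ Finset.Icc 1 k,
      (-1 : ℝ) ^ l * (∏ i ∈ Finset.range l, a (k + 1 - i)) * (d (k - l) / d k) * y (k - l)) :
    ∀ k : ℕ, |z k| ≤ ∑ l ∈ Finset.range (k + 1),
      θ ^ l * (|b (k + 1)| / |b (k - l + 1)|) * |y (k - l)| := by
  have hs := Real.sqrt_nonneg (1 / 4 - δ ^ 2)
  have hsq := Real.sq_sqrt (show 0 ≤ 1 / 4 - δ ^ 2 by nlinarith)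
  have hγ0 : 0 < γ := by linarith
  have hγδ : γ * (1 - γ) = δ ^ 2 := by
    rw [hγ]
    linear_combination -hsq
  have hγ1 : γ ≤ 1 := by nlinarith [sq_nonneg δ]
  have hgrow := mul_abs_le_abs_succ hδ0.le hγ1 hγδ ha hc hd0 hd1 hd
  have hdpos : ∀ n, 0 < |d n| := by
    intro n
    induction n with
    | zero => simp [hd0]
    | succ n ih =>
      have := abs_pos.2 (hb (n + 1) (by omega))
      exact lt_of_lt_of_le (by positivity) (hgrow n)
  intro k
  have hz : z k = ∑ l ∈ Finset.range (k + 1),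
      (-1 : ℝ) ^ l * (∏ i ∈ Finset.range l, a (k + 1 - i)) * (d (k - l) / d k) * y (k - l) := by
    have hk := div_self (abs_pos.1 (hdpos k))
    rcases Nat.eq_zero_or_pos k with rfl | hk1
    · simp [hz0, hk]
    · rw [hzk k hk1, Finset.range_eq_Ico, Finset.sum_eq_sum_Ico_succ_bot (by omega)]
      simp [hk, Finset.Ico_add_one_right_eq_Icc]
  rw [hz]
  refine (Finset.abs_sum_le_sum_abs _ _).trans (Finset.sum_le_sum fun l hl => ?_)
  have hlk : l ≤ k := Nat.lt_succ_iff.1 (Finset.mem_range.1 hl)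
  have hbpos := abs_pos.2 (hb (k - l + 1) (by omega))
  have hdk := hdpos k
  rw [abs_mul, abs_mul, abs_mul, abs_pow, abs_neg, abs_one, one_pow, one_mul, abs_div]
  refine mul_le_mul_of_nonneg_right ?_ (abs_nonneg _)
  rw [hθ, div_pow, div_mul_div_comm, ← mul_div_assoc, div_le_div_iff₀ hdk (by positivity),
    ← mul_assoc]
  exact abs_prod_mul_le_pow_mul hδ0.le hγ0.le ha hgrow hlk
end

section
/- Let s > 1. If sup_{k≥0} |y_k| (m+k)^s < ∞, then sup_{k≥0} |z_k| (m+k)^s < ∞. (In other words, L⁻¹ maps Ω^s into Ω^s.) -/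
/-- A three-term recurrence with diagonally dominant coefficients grows at least like `γ |b_n|`. -/
theorem abs_recurrence_lower_bound {δ γ : ℝ} (hδ : 0 < δ) (hγ1 : γ ≤ 1)
    (hγδ : γ * (1 - γ) = δ ^ 2) {a b c d : ℕ → ℝ}
    (ha : ∀ n, 2 ≤ n → |a n| ≤ δ * |b n|) (hc : ∀ n, 1 ≤ n → |c n| ≤ δ * |b n|)
    (hd0 : d 0 = 1) (hd1 : d 1 = b 1)
    (hd : ∀ n : ℕ, d (n + 2) = b (n + 2) * d (n + 1) - a (n + 2) * c (n + 1) * d n) (n : ℕ) :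
    γ * (|b (n + 1)| * |d n|) ≤ |d (n + 1)| := by
  induction n with
  | zero =>
    rw [hd0, zero_add, hd1, abs_one, mul_one]
    exact mul_le_of_le_one_left (abs_nonneg _) hγ1
  | succ n ih =>
    have hac : |a (n + 2) * c (n + 1) * d n| ≤ (1 - γ) * (|b (n + 2)| * |d (n + 1)|) := by
      rw [abs_mul, abs_mul]
      calc |a (n + 2)| * |c (n + 1)| * |d n|
          ≤ (δ * |b (n + 2)|) * (δ * |b (n + 1)|) * |d n| := by
            gcongr
            · exact ha _ (by lia)
            · exact hc _ (by lia)
        _ = (1 - γ) * (|b (n + 2)| * (γ * (|b (n + 1)| * |d n|))) := by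
            linear_combination -(|b (n + 2)| * |b (n + 1)| * |d n|) * hγδ
        _ ≤ _ := by
            have := sub_nonneg.2 hγ1
            gcongr
    have htri := abs_sub_abs_le_abs_sub (b (n + 2) * d (n + 1)) (a (n + 2) * c (n + 1) * d n)
    rw [← hd, abs_mul (b _)] at htri
    change γ * (|b (n + 2)| * |d (n + 1)|) ≤ |d (n + 2)|
    linarith

/-- Products of the subdiagonal entries decay geometrically relative to the recurrence `d`. -/
theorem abs_prod_mul_le_pow {δ γ : ℝ} (hδ : 0 < δ) (hγ0 : 0 < γ) {a b d : ℕ → ℝ}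
    (ha : ∀ n, 2 ≤ n → |a n| ≤ δ * |b n|)
    (hlow : ∀ n, γ * (|b (n + 1)| * |d n|) ≤ |d (n + 1)|) {k l : ℕ} (hl : l ≤ k) :
    |∏ i ∈ Finset.range l, a (k + 1 - i)| * (|b (k - l + 1)| * |d (k - l)|)
      ≤ (δ / γ) ^ l * (|b (k + 1)| * |d k|) := by
  induction l with
  | zero => simp
  | succ l ih =>
    refine le_trans ?_ (mul_le_mul_of_nonneg_left (ih (by lia)) (div_pos hδ hγ0).le |>.trans_eq
      (by rw [pow_succ']; ring))
    obtain ⟨n, rfl⟩ : ∃ n, k = n + l + 1 := ⟨k - (l + 1), by lia⟩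
    rw [Finset.prod_range_succ, abs_mul, show n + l + 1 + 1 - l = n + 2 by lia,
      show n + l + 1 - (l + 1) = n by lia, show n + l + 1 - l = n + 1 by lia]
    calc |∏ i ∈ Finset.range l, a (n + l + 1 + 1 - i)| * |a (n + 2)| * (|b (n + 1)| * |d n|)
        ≤ |∏ i ∈ Finset.range l, a (n + l + 1 + 1 - i)| * (δ * |b (n + 2)|)
          * (|d (n + 1)| / γ) := by
          gcongr
          · exact ha _ (by lia)
          · rw [le_div_iff₀ hγ0, mul_comm]
            exact hlow n
      _ = _ := by ring

theorem summable_pow_mul_succ_rpow {θ : ℝ} (hθ0 : 0 < θ) (hθ1 : θ < 1) (p : ℝ) :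
    Summable fun l : ℕ => θ ^ l * (1 + (l : ℝ)) ^ p := by
  have hs := summable_pow_mul_geometric_of_norm_lt_one ⌈p⌉₊
    (show ‖θ‖ < 1 by rwa [Real.norm_of_nonneg hθ0.le])
  refine Summable.of_nonneg_of_le (fun l => by positivity) (fun l => ?_)
    (((summable_nat_add_iff 1).2 hs).mul_left θ⁻¹)
  have hp : (1 + (l : ℝ)) ^ p ≤ (1 + (l : ℝ)) ^ ⌈p⌉₊ := by
    rw [← Real.rpow_natCast]
    exact Real.rpow_le_rpow_of_exponent_le (by simp) (Nat.le_ceil p)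
  calc θ ^ l * (1 + (l : ℝ)) ^ p ≤ θ ^ l * (1 + (l : ℝ)) ^ ⌈p⌉₊ := by gcongr
    _ = _ := by
      push_cast
      rw [pow_succ, add_comm (1 : ℝ)]
      field_simp

/-- `L⁻¹` maps `Ω^s` into `Ω^s`: if `sup_{k≥0} |y_k| (m+k)^s < ∞`,
then `sup_{k≥0} |z_k| (m+k)^s < ∞`, where `z = L⁻¹ y`.
Here `C₁ (m+n-1)^{s_L} ≤ |b_n| ≤ C₂ (m+n-1)^{s_L}` for all `n ≥ 1` is expressed
with `n = k+1` as `C₁ (m+k)^{s_L} ≤ |b_{k+1}| ≤ C₂ (m+k)^{s_L}`. -/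
theorem statement4 (δ : ℝ) (hδ0 : 0 < δ) (hδ1 : δ < 1 / 2)
    (a b c : ℕ → ℝ)
    (hb : ∀ n, 1 ≤ n → b n ≠ 0)
    (ha : ∀ n, 2 ≤ n → |a n| ≤ δ * |b n|)
    (hc : ∀ n, 1 ≤ n → |c n| ≤ δ * |b n|)
    (d : ℕ → ℝ)
    (hd0 : d 0 = 1) (hd1 : d 1 = b 1)
    (hd : ∀ n : ℕ, d (n + 2) = b (n + 2) * d (n + 1) - a (n + 2) * c (n + 1) * d n)
    (γ θ : ℝ) (hγ : γ = 1 / 2 + Real.sqrt (1 / 4 - δ ^ 2)) (hθ : θ = δ / γ)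
    (m : ℕ) (hm : 1 ≤ m) (sL C₁ C₂ : ℝ) (hsL : 0 < sL) (hC₁ : 0 < C₁) (hC₁₂ : C₁ ≤ C₂)
    (hblow : ∀ k : ℕ, C₁ * ((m : ℝ) + k) ^ sL ≤ |b (k + 1)|)
    (hbup : ∀ k : ℕ, |b (k + 1)| ≤ C₂ * ((m : ℝ) + k) ^ sL)
    (y z : ℕ → ℝ)
    (hz0 : z 0 = y 0)
    (hzk : ∀ k, 1 ≤ k → z k = y k + ∑ l ∈ Finset.Icc 1 k,
      (-1 : ℝ) ^ l * (∏ i ∈ Finset.range l, a (k + 1 - i)) * (d (k - l) / d k) * y (k - l))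
    (s : ℝ) (hs : 1 < s)
    (hy : BddAbove (Set.range fun k => |y k| * ((m : ℝ) + k) ^ s)) :
    BddAbove (Set.range fun k => |z k| * ((m : ℝ) + k) ^ s) := by
  have hsq : Real.sqrt (1 / 4 - δ ^ 2) ^ 2 = 1 / 4 - δ ^ 2 := Real.sq_sqrt (by nlinarith)
  have hsq0 := Real.sqrt_nonneg (1 / 4 - δ ^ 2)
  have hγ0 : 0 < γ := by linarith
  have hγ1 : γ ≤ 1 := by rw [hγ]; nlinarith
  have hγδ : γ * (1 - γ) = δ ^ 2 := by rw [hγ]; linear_combination -hsq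
  have hθ0 : 0 < θ := hθ ▸ div_pos hδ0 hγ0
  have hθ1 : θ < 1 := by rw [hθ, div_lt_one hγ0]; linarith
  have hlow := abs_recurrence_lower_bound hδ0 hγ1 hγδ ha hc hd0 hd1 hd
  have hdpos : ∀ n, 0 < |d n| := by
    intro n
    induction n with
    | zero => simp [hd0]
    | succ n ih =>
      have := abs_pos.2 (hb (n + 1) (by lia))
      exact lt_of_lt_of_le (by positivity) (hlow n)
  obtain ⟨M, hM⟩ := hy
  replace hM : ∀ k : ℕ, |y k| * ((m : ℝ) + k) ^ s ≤ M := fun k => hM ⟨k, rfl⟩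
  have hm1 : (1 : ℝ) ≤ m := by exact_mod_cast hm
  have hM0 : 0 ≤ M := le_trans (by positivity) (hM 0)
  have hz : ∀ k, z k = ∑ l ∈ Finset.range (k + 1),
      (-1 : ℝ) ^ l * (∏ i ∈ Finset.range l, a (k + 1 - i)) * (d (k - l) / d k) * y (k - l) := by
    intro k
    rw [Finset.range_eq_Ico, Finset.sum_eq_sum_Ico_succ_bot (by lia)]
    have hdk : d k / d k = 1 := div_self (abs_pos.1 (hdpos k))
    rcases Nat.eq_zero_or_pos k with rfl | hk
    · simp [hz0, hd0]
    · rw [hzk k hk]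
      simp only [pow_zero, Finset.range_zero, Finset.prod_empty, Nat.sub_zero, hdk, one_mul]
      rfl
  have hterm : ∀ k l : ℕ, l ≤ k →
      |(-1 : ℝ) ^ l * (∏ i ∈ Finset.range l, a (k + 1 - i)) * (d (k - l) / d k) * y (k - l)|
        * ((m : ℝ) + k) ^ s ≤ C₂ / C₁ * M * (θ ^ l * (1 + (l : ℝ)) ^ (sL + s)) := by
    intro k l hl
    have hprod := abs_prod_mul_le_pow hδ0 hγ0 ha hlow hl
    rw [← hθ] at hprod
    obtain ⟨n, rfl⟩ : ∃ n, k = n + l := ⟨k - l, by lia⟩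
    rw [Nat.add_sub_cancel] at hprod ⊢
    simp only [abs_mul, abs_div, abs_pow, abs_neg, abs_one, one_pow, one_mul]
    have hbn := abs_pos.2 (hb (n + 1) (by lia))
    have hdk := hdpos (n + l)
    have hY : (1 : ℝ) ≤ (m : ℝ) + n := by linarith [n.cast_nonneg (α := ℝ)]
    have hY0 : (0 : ℝ) < (m : ℝ) + n := by linarith
    have hXY : (m : ℝ) + (n + l : ℕ) ≤ (1 + l) * (m + n) := by
      push_cast
      nlinarith [l.cast_nonneg (α := ℝ)]
    have hX0 : (0 : ℝ) < (m : ℝ) + (n + l : ℕ) := by positivity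
    have hC₂ : 0 < C₂ := hC₁.trans_le hC₁₂
    have hratio : |∏ i ∈ Finset.range l, a (n + l + 1 - i)| * (|d n| / |d (n + l)|)
        ≤ θ ^ l * |b (n + l + 1)| / |b (n + 1)| := by
      rw [← mul_div_assoc, div_le_div_iff₀ hdk hbn]
      linarith
    calc _ ≤ θ ^ l * (C₂ * ((m : ℝ) + (n + l : ℕ)) ^ sL) / (C₁ * ((m : ℝ) + n) ^ sL)
          * (M / ((m : ℝ) + n) ^ s) * ((m : ℝ) + (n + l : ℕ)) ^ s := by
          gcongr
          · refine hratio.trans ?_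
            gcongr
            · exact hbup (n + l)
            · exact hblow n
          · rw [le_div_iff₀ (by positivity)]
            exact hM n
      _ = C₂ / C₁ * M * (θ ^ l * (((m : ℝ) + (n + l : ℕ)) ^ (sL + s)
          / ((m : ℝ) + n) ^ (sL + s))) := by
          rw [Real.rpow_add hX0, Real.rpow_add hY0]
          field_simp
      _ ≤ _ := by
          gcongr
          rw [div_le_iff₀ (by positivity), ← Real.mul_rpow (by positivity) hY0.le]
          exact Real.rpow_le_rpow hX0.le hXY (by linarith)
  have hsum := (summable_pow_mul_succ_rpow hθ0 hθ1 (sL + s)).mul_left (C₂ / C₁ * M)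
  refine ⟨∑' l : ℕ, C₂ / C₁ * M * (θ ^ l * (1 + (l : ℝ)) ^ (sL + s)), ?_⟩
  rintro _ ⟨k, rfl⟩
  have hC₂ : 0 < C₂ := hC₁.trans_le hC₁₂
  calc |z k| * ((m : ℝ) + k) ^ s
      ≤ (∑ l ∈ Finset.range (k + 1), |(-1 : ℝ) ^ l * (∏ i ∈ Finset.range l, a (k + 1 - i))
          * (d (k - l) / d k) * y (k - l)|) * ((m : ℝ) + k) ^ s := by
        gcongr
        rw [hz k]
        exact Finset.abs_sum_le_sum_abs _ _
    _ ≤ ∑ l ∈ Finset.range (k + 1), C₂ / C₁ * M * (θ ^ l * (1 + (l : ℝ)) ^ (sL + s)) := by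
        rw [Finset.sum_mul]
        exact Finset.sum_le_sum fun l hl => hterm k l (by simpa [Nat.lt_succ_iff] using hl)
    _ ≤ _ := hsum.sum_le_tsum _ fun l _ => by positivity
end

section
/- If (z_k)_{k≥0} is a bounded real sequence, then for every k ≥ 0 the series defining x_k converges absolutely and |x_k| ≤ Σ_{l=0}^{∞} θ^l |z_{k+l}| / (γ |b_{k+l+1}|). -/
/-- The general term (index `l`) of the series defining `x = U⁻¹ z`:
`(−1)^l (δ_k/δ_{k+l+1}) c_{k+1}⋯c_{k+l} z_{k+l}`. -/
noncomputable def Uterm (c d z : ℕ → ℝ) (k l : ℕ) : ℝ :=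
  (-1 : ℝ) ^ l * (d k / d (k + l + 1)) * (∏ i ∈ Finset.range l, c (k + 1 + i)) * z (k + l)

/-- The recursion `d (n+2) = b (n+2) d (n+1) − a (n+2) c (n+1) d n` with off-diagonal coefficients
dominated by `δ |b|` grows at least geometrically relative to `b`, with ratio a root `γ` of
`γ (1 − γ) = δ²`. -/
lemma mul_abs_le_abs_succ_of_dominant {δ γ : ℝ} {a b c d : ℕ → ℝ} (hδ : 0 ≤ δ) (hγ1 : γ ≤ 1)
    (hγδ : γ * (1 - γ) = δ ^ 2)
    (ha : ∀ n, 2 ≤ n → |a n| ≤ δ * |b n|) (hc : ∀ n, 1 ≤ n → |c n| ≤ δ * |b n|)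
    (hd0 : d 0 = 1) (hd1 : d 1 = b 1)
    (hd : ∀ n : ℕ, d (n + 2) = b (n + 2) * d (n + 1) - a (n + 2) * c (n + 1) * d n) (n : ℕ) :
    γ * |b (n + 1)| * |d n| ≤ |d (n + 1)| := by
  induction n with
  | zero =>
    simp only [zero_add, hd0, hd1, abs_one, mul_one]
    exact mul_le_of_le_one_left (abs_nonneg _) hγ1
  | succ n ih =>
    have hsub : |b (n + 2)| * |d (n + 1)| - |a (n + 2)| * |c (n + 1)| * |d n| ≤ |d (n + 2)| := by
      rw [hd n]
      simpa only [abs_mul] using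
        abs_sub_abs_le_abs_sub (b (n + 2) * d (n + 1)) (a (n + 2) * c (n + 1) * d n)
    have hac : |a (n + 2)| * |c (n + 1)| * |d n| ≤
        δ * |b (n + 2)| * (δ * |b (n + 1)|) * |d n| := by
      gcongr
      · exact ha _ (by omega)
      · exact hc _ (by omega)
    have hstep : δ * |b (n + 2)| * (δ * |b (n + 1)|) * |d n| ≤
        (1 - γ) * |b (n + 2)| * |d (n + 1)| := by
      calc δ * |b (n + 2)| * (δ * |b (n + 1)|) * |d n|
          = (1 - γ) * |b (n + 2)| * (γ * |b (n + 1)| * |d n|) := by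
            linear_combination (-(|b (n + 2)| * |b (n + 1)| * |d n|)) * hγδ
        _ ≤ (1 - γ) * |b (n + 2)| * |d (n + 1)| :=
            mul_le_mul_of_nonneg_left ih (mul_nonneg (by linarith) (abs_nonneg _))
    change γ * |b (n + 2)| * |d (n + 1)| ≤ |d (n + 2)|
    linarith

/-- Geometric growth of `d` relative to `b`, with `|c| ≤ δ |b|`, makes the coefficients of the
series `Uterm` decay geometrically. -/
lemma abs_Uterm_le {δ γ : ℝ} {b c d : ℕ → ℝ} (hδ : 0 ≤ δ) (hγ : 0 < γ)
    (hb : ∀ n, 1 ≤ n → b n ≠ 0) (hc : ∀ n, 1 ≤ n → |c n| ≤ δ * |b n|)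
    (hd0 : d 0 ≠ 0) (hgrow : ∀ n, γ * |b (n + 1)| * |d n| ≤ |d (n + 1)|)
    (z : ℕ → ℝ) (k l : ℕ) :
    |Uterm c d z k l| ≤ (δ / γ) ^ l * |z (k + l)| / (γ * |b (k + l + 1)|) := by
  have hbpos : ∀ n, 0 < |b (n + 1)| := fun n => abs_pos.2 (hb _ (by omega))
  have hdpos : ∀ n, 0 < |d n| := by
    intro n
    induction n with
    | zero => exact abs_pos.2 hd0
    | succ n ih => exact lt_of_lt_of_le (mul_pos (mul_pos hγ (hbpos n)) ih) (hgrow n)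
  have key : |d k| * |∏ i ∈ Finset.range l, c (k + 1 + i)| * (γ * |b (k + l + 1)|) ≤
      (δ / γ) ^ l * |d (k + l + 1)| := by
    induction l with
    | zero => simpa [mul_comm, mul_left_comm, mul_assoc] using hgrow k
    | succ l ih =>
      rw [Finset.prod_range_succ, abs_mul]
      have hcl : |c (k + 1 + l)| ≤ δ * |b (k + l + 1)| := by
        rw [show k + 1 + l = k + l + 1 by omega]
        exact hc _ (by omega)
      change _ * (γ * |b (k + l + 1 + 1)|) ≤ _ * |d (k + l + 1 + 1)|
      calc |d k| * (|∏ i ∈ Finset.range l, c (k + 1 + i)| * |c (k + 1 + l)|) *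
            (γ * |b (k + l + 1 + 1)|)
          ≤ |d k| * (|∏ i ∈ Finset.range l, c (k + 1 + i)| * (δ * |b (k + l + 1)|)) *
            (γ * |b (k + l + 1 + 1)|) := by gcongr
        _ = |d k| * |∏ i ∈ Finset.range l, c (k + 1 + i)| * (γ * |b (k + l + 1)|) *
            (δ * |b (k + l + 1 + 1)|) := by ring
        _ ≤ (δ / γ) ^ l * |d (k + l + 1)| * (δ * |b (k + l + 1 + 1)|) := by gcongr
        _ = (δ / γ) ^ (l + 1) * (γ * |b (k + l + 1 + 1)| * |d (k + l + 1)|) := by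
            rw [pow_succ]; field_simp
        _ ≤ (δ / γ) ^ (l + 1) * |d (k + l + 1 + 1)| := by gcongr; exact hgrow _
  have hcoef : |d k| / |d (k + l + 1)| * |∏ i ∈ Finset.range l, c (k + 1 + i)| ≤
      (δ / γ) ^ l / (γ * |b (k + l + 1)|) := by
    rw [div_mul_eq_mul_div, div_le_div_iff₀ (hdpos _) (mul_pos hγ (hbpos _))]
    exact key
  calc |Uterm c d z k l|
      = |d k| / |d (k + l + 1)| * |∏ i ∈ Finset.range l, c (k + 1 + i)| * |z (k + l)| := by
        simp only [Uterm, abs_mul, abs_div, abs_pow, abs_neg, abs_one, one_pow, one_mul]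
    _ ≤ (δ / γ) ^ l / (γ * |b (k + l + 1)|) * |z (k + l)| := by gcongr
    _ = _ := by ring

/-- if `(z_k)` is a bounded real sequence, then for every `k ≥ 0`
the series defining `x_k = (δ_k/δ_{k+1}) z_k + Σ_{l=1}^{∞} (−1)^l (δ_k/δ_{k+l+1})
c_{k+1}⋯c_{k+l} z_{k+l}` converges absolutely and
`|x_k| ≤ Σ_{l=0}^{∞} θ^l |z_{k+l}| / (γ |b_{k+l+1}|)`. -/
theorem statement5 (δ : ℝ) (hδ0 : 0 < δ) (hδ1 : δ < 1 / 2)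
    (a b c : ℕ → ℝ)
    (hb : ∀ n, 1 ≤ n → b n ≠ 0)
    (ha : ∀ n, 2 ≤ n → |a n| ≤ δ * |b n|)
    (hc : ∀ n, 1 ≤ n → |c n| ≤ δ * |b n|)
    (d : ℕ → ℝ)
    (hd0 : d 0 = 1) (hd1 : d 1 = b 1)
    (hd : ∀ n : ℕ, d (n + 2) = b (n + 2) * d (n + 1) - a (n + 2) * c (n + 1) * d n)
    (γ θ : ℝ) (hγ : γ = 1 / 2 + Real.sqrt (1 / 4 - δ ^ 2)) (hθ : θ = δ / γ)
    (m : ℕ) (hm : 1 ≤ m) (sL C₁ : ℝ) (hsL : 0 < sL) (hC₁ : 0 < C₁)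
    (hblow : ∀ k : ℕ, C₁ * ((m : ℝ) + k) ^ sL ≤ |b (k + 1)|)
    (z : ℕ → ℝ) (hzbdd : ∃ B : ℝ, ∀ k, |z k| ≤ B) :
    ∀ k : ℕ, Summable (fun l : ℕ => |Uterm c d z k (l + 1)|) ∧
      |d k / d (k + 1) * z k + ∑' l : ℕ, Uterm c d z k (l + 1)| ≤
        ∑' l : ℕ, θ ^ l * |z (k + l)| / (γ * |b (k + l + 1)|) := by
  intro k
  have hsq : Real.sqrt (1 / 4 - δ ^ 2) ^ 2 = 1 / 4 - δ ^ 2 := Real.sq_sqrt (by nlinarith)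
  have hs0 := Real.sqrt_nonneg (1 / 4 - δ ^ 2)
  have hγhalf : 1 / 2 ≤ γ := by linarith
  have hγpos : 0 < γ := by linarith
  have hγδ : γ * (1 - γ) = δ ^ 2 := by rw [hγ]; linear_combination -hsq
  have hγ1 : γ ≤ 1 := by nlinarith
  have hθ0 : 0 ≤ θ := hθ ▸ div_nonneg hδ0.le hγpos.le
  have hθ1 : θ < 1 := by rw [hθ, div_lt_one hγpos]; linarith
  have hle : ∀ l, |Uterm c d z k l| ≤ θ ^ l * |z (k + l)| / (γ * |b (k + l + 1)|) := hθ ▸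
    abs_Uterm_le hδ0.le hγpos hb hc (by simp [hd0])
      (mul_abs_le_abs_succ_of_dominant hδ0.le hγ1 hγδ ha hc hd0 hd1 hd) z k
  have hbC : ∀ n : ℕ, C₁ ≤ |b (n + 1)| := fun n => by
    have hm' : (1 : ℝ) ≤ m := by exact_mod_cast hm
    refine le_trans (le_mul_of_one_le_right hC₁.le ?_) (hblow n)
    exact Real.one_le_rpow (by linarith [n.cast_nonneg (α := ℝ)]) hsL.le
  obtain ⟨B, hB⟩ := hzbdd
  have hB0 : 0 ≤ B := (abs_nonneg _).trans (hB 0)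
  have hmaj : Summable fun l : ℕ => θ ^ l * |z (k + l)| / (γ * |b (k + l + 1)|) := by
    refine Summable.of_nonneg_of_le (fun l => by positivity) (fun l => ?_)
      ((summable_geometric_of_lt_one hθ0 hθ1).mul_right (B / (γ * C₁)))
    rw [← mul_div_assoc]
    gcongr
    · exact hB _
    · exact hbC _
  have habs : Summable fun l => |Uterm c d z k l| :=
    Summable.of_nonneg_of_le (fun l => abs_nonneg _) hle hmaj
  refine ⟨(summable_nat_add_iff 1).2 habs, ?_⟩
  have hx : d k / d (k + 1) * z k + ∑' l : ℕ, Uterm c d z k (l + 1) = ∑' l, Uterm c d z k l := by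
    rw [habs.of_abs.tsum_eq_zero_add]
    simp [Uterm]
  rw [hx]
  exact tsum_of_norm_bounded (f := Uterm c d z k) hmaj.hasSum hle
end

section
/- Let s > 1 and suppose sup_{k≥0} |y_k| (m+k)^s < ∞. Then all the series occurring in the definition of G y converge absolutely and for every k ≥ 0, |(G y)_k| ≤ η ( Σ_{j=0}^{k} θ^{k−j} |y_j|/|b_{j+1}| + Σ_{j=k+1}^{∞} θ^{j−k} |y_j|/|b_{j+1}| ). -/
/-- `U⁻¹ z` : `(U⁻¹z)_k = (δ_k/δ_{k+1}) z_k + Σ_{l=1}^{∞} (−1)^l (δ_k/δ_{k+l+1})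
c_{k+1}⋯c_{k+l} z_{k+l}`. -/
noncomputable def Uinv (c d z : ℕ → ℝ) (k : ℕ) : ℝ :=
  d k / d (k + 1) * z k + ∑' l : ℕ, Uterm c d z k (l + 1)

/-- Lower bound on the growth of the continuants of a diagonally dominant tridiagonal matrix. -/
theorem continuant_growth {δ γ : ℝ} (hδ : 0 ≤ δ) (hγ0 : 0 < γ) (hγ1 : γ ≤ 1)
    (hγδ : γ - γ ^ 2 = δ ^ 2) {a b c d : ℕ → ℝ}
    (ha : ∀ n, 2 ≤ n → |a n| ≤ δ * |b n|) (hc : ∀ n, 1 ≤ n → |c n| ≤ δ * |b n|)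
    (hd0 : d 0 = 1) (hd1 : d 1 = b 1)
    (hd : ∀ n : ℕ, d (n + 2) = b (n + 2) * d (n + 1) - a (n + 2) * c (n + 1) * d n) (n : ℕ) :
    γ * |b (n + 1)| * |d n| ≤ |d (n + 1)| := by
  induction n with
  | zero =>
    rw [zero_add, hd0, hd1, abs_one, mul_one]
    exact mul_le_of_le_one_left (abs_nonneg _) hγ1
  | succ n ih =>
    have hac : |a (n + 2)| * |c (n + 1)| ≤ δ * |b (n + 2)| * (δ * |b (n + 1)|) :=
      mul_le_mul (ha _ (by omega)) (hc _ (by omega)) (abs_nonneg _) (by positivity)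
    have hacd : γ * (|a (n + 2)| * |c (n + 1)| * |d n|) ≤
        δ ^ 2 * |b (n + 2)| * |d (n + 1)| := by
      calc γ * (|a (n + 2)| * |c (n + 1)| * |d n|)
          ≤ γ * (δ * |b (n + 2)| * (δ * |b (n + 1)|) * |d n|) := by gcongr
        _ = δ ^ 2 * |b (n + 2)| * (γ * |b (n + 1)| * |d n|) := by ring
        _ ≤ _ := by gcongr
    have hsub : |b (n + 2)| * |d (n + 1)| - |a (n + 2)| * |c (n + 1)| * |d n| ≤ |d (n + 2)| := by
      rw [hd, ← abs_mul, ← abs_mul, ← abs_mul]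
      exact abs_sub_abs_le_abs_sub _ _
    refine le_of_mul_le_mul_left ?_ hγ0
    calc γ * (γ * |b (n + 2)| * |d (n + 1)|)
        = γ * (|b (n + 2)| * |d (n + 1)|) - δ ^ 2 * |b (n + 2)| * |d (n + 1)| := by
          rw [← hγδ]; ring
      _ ≤ γ * (|b (n + 2)| * |d (n + 1)|) - γ * (|a (n + 2)| * |c (n + 1)| * |d n|) := by gcongr
      _ = γ * (|b (n + 2)| * |d (n + 1)| - |a (n + 2)| * |c (n + 1)| * |d n|) := by ring
      _ ≤ γ * |d (n + 2)| := by gcongr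

theorem prod_upper_le {δ γ : ℝ} (hδ : 0 ≤ δ) (hγ0 : 0 < γ) {b c d : ℕ → ℝ}
    (hc : ∀ n, 1 ≤ n → |c n| ≤ δ * |b n|)
    (hgrow : ∀ n, γ * |b (n + 1)| * |d n| ≤ |d (n + 1)|) (k l : ℕ) :
    |d k| * ∏ i ∈ Finset.range l, |c (k + 1 + i)| ≤ (δ / γ) ^ l * |d (k + l)| := by
  induction l with
  | zero => simp
  | succ l ih =>
    rw [Finset.prod_range_succ, ← mul_assoc]
    calc |d k| * (∏ i ∈ Finset.range l, |c (k + 1 + i)|) * |c (k + 1 + l)|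
        ≤ (δ / γ) ^ l * |d (k + l)| * (δ * |b (k + 1 + l)|) := by
          gcongr
          exact hc _ (by omega)
      _ = (δ / γ) ^ (l + 1) * (γ * |b (k + l + 1)| * |d (k + l)|) := by
          rw [show k + 1 + l = k + l + 1 by omega, pow_succ]; field_simp
      _ ≤ _ := by
          gcongr
          exact hgrow _

theorem prod_lower_le {δ γ : ℝ} (hδ : 0 ≤ δ) (hγ0 : 0 < γ) {a b d : ℕ → ℝ}
    (ha : ∀ n, 2 ≤ n → |a n| ≤ δ * |b n|)
    (hgrow : ∀ n, γ * |b (n + 1)| * |d n| ≤ |d (n + 1)|) (k l : ℕ) (hl : l ≤ k) :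
    (∏ i ∈ Finset.range l, |a (k + 1 - i)|) * |d (k - l)| * |b (k - l + 1)| ≤
      (δ / γ) ^ l * (|d k| * |b (k + 1)|) := by
  induction l with
  | zero => simp
  | succ l ih =>
    obtain ⟨j, rfl⟩ : ∃ j, k = l + 1 + j := ⟨k - (l + 1), by omega⟩
    have ih := ih (by omega)
    rw [show l + 1 + j - l = j + 1 by omega] at ih
    rw [Finset.prod_range_succ, show l + 1 + j - (l + 1) = j by omega,
      show l + 1 + j + 1 - l = j + 2 by omega]
    set P := ∏ i ∈ Finset.range l, |a (l + 1 + j + 1 - i)|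
    have hP : 0 ≤ P := Finset.prod_nonneg fun _ _ => abs_nonneg _
    calc P * |a (j + 2)| * |d j| * |b (j + 1)|
        ≤ P * (δ * |b (j + 2)|) * |d j| * |b (j + 1)| := by
          gcongr
          exact ha _ (by omega)
      _ = δ / γ * (P * (γ * |b (j + 1)| * |d j|) * |b (j + 2)|) := by field_simp
      _ ≤ δ / γ * (P * |d (j + 1)| * |b (j + 2)|) := by
          gcongr
          exact hgrow _
      _ ≤ δ / γ * ((δ / γ) ^ l * (|d (l + 1 + j)| * |b (l + 1 + j + 1)|)) := by gcongr
      _ = _ := by ring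

theorem sum_geometric_weight_succ (θ : ℝ) (v : ℕ → ℝ) (n : ℕ) :
    ∑ j ∈ Finset.range (n + 2), θ ^ (n + 1 - j) * v j =
      θ * (∑ j ∈ Finset.range (n + 1), θ ^ (n - j) * v j) + v (n + 1) := by
  rw [Finset.sum_range_succ, Finset.mul_sum]
  congr 1
  · refine Finset.sum_congr rfl fun j hj => ?_
    have hj := Finset.mem_range.mp hj
    rw [show n + 1 - j = n - j + 1 by omega]
    ring
  · simp

theorem hasSum_geometric_of_recurrence {θ B : ℝ} (hθ0 : 0 ≤ θ) (hθ1 : θ < 1) {v w : ℕ → ℝ}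
    (hv0 : ∀ n, 0 ≤ v n) (hvB : ∀ n, v n ≤ B) (hw0 : w 0 = v 0)
    (hw : ∀ n, w (n + 1) = θ * w n + v (n + 1)) (k : ℕ) :
    Summable (fun i : ℕ => θ ^ (i + 1) * v (k + 1 + i)) ∧
      HasSum (fun l : ℕ => θ ^ l * w (k + l))
        ((w k + ∑' i : ℕ, θ ^ (i + 1) * v (k + 1 + i)) / (1 - θ ^ 2)) := by
  have h1 : 0 < 1 - θ := sub_pos.mpr hθ1
  have hB : 0 ≤ B := (hv0 0).trans (hvB 0)
  have hwB : ∀ n, 0 ≤ w n ∧ w n ≤ B / (1 - θ) := by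
    intro n
    induction n with
    | zero =>
      rw [hw0]
      exact ⟨hv0 0, (hvB 0).trans (le_div_self hB h1 (by linarith))⟩
    | succ n ih =>
      rw [hw]
      refine ⟨add_nonneg (mul_nonneg hθ0 ih.1) (hv0 _), ?_⟩
      calc θ * w n + v (n + 1) ≤ θ * (B / (1 - θ)) + B :=
            add_le_add (mul_le_mul_of_nonneg_left ih.2 hθ0) (hvB _)
        _ = B / (1 - θ) := by field_simp; ring
  have hgeo := summable_geometric_of_lt_one hθ0 hθ1
  have hV : Summable (fun i : ℕ => θ ^ (i + 1) * v (k + 1 + i)) := by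
    refine Summable.of_nonneg_of_le (fun i => mul_nonneg (by positivity) (hv0 _)) (fun i => ?_)
      (((summable_nat_add_iff 1).mpr hgeo).mul_right B)
    exact mul_le_mul_of_nonneg_left (hvB _) (by positivity)
  have hT : Summable (fun l : ℕ => θ ^ l * w (k + l)) := by
    refine Summable.of_nonneg_of_le (fun i => mul_nonneg (by positivity) (hwB _).1) (fun i => ?_)
      (hgeo.mul_right (B / (1 - θ)))
    exact mul_le_mul_of_nonneg_left (hwB _).2 (by positivity)
  refine ⟨hV, ?_⟩
  convert hT.hasSum using 1
  have hstep : ∀ l, θ ^ (l + 1) * w (k + (l + 1)) =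
      θ ^ 2 * (θ ^ l * w (k + l)) + θ ^ (l + 1) * v (k + 1 + l) := by
    intro l
    rw [← add_assoc, hw, show k + 1 + l = k + l + 1 by omega]
    ring
  have hsum := hT.tsum_eq_zero_add
  rw [tsum_congr hstep, (hT.mul_left _).tsum_add hV, tsum_mul_left] at hsum
  simp only [pow_zero, one_mul, add_zero] at hsum
  have h2 : 1 - θ ^ 2 ≠ 0 := by nlinarith
  rw [div_eq_iff h2]
  linarith

/-- for `G y = U⁻¹(L⁻¹ y)` with `sup_{k≥0} |y_k| (m+k)^s < ∞` (`s > 1`),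
all the series occurring in the definition of `G y` converge absolutely and for every
`k ≥ 0`, `|(G y)_k| ≤ η (Σ_{j=0}^{k} θ^{k−j} |y_j|/|b_{j+1}|
+ Σ_{j=k+1}^{∞} θ^{j−k} |y_j|/|b_{j+1}|)`. -/
theorem statement7 (δ : ℝ) (hδ0 : 0 < δ) (hδ1 : δ < 1 / 2)
    (a b c : ℕ → ℝ)
    (hb : ∀ n, 1 ≤ n → b n ≠ 0)
    (ha : ∀ n, 2 ≤ n → |a n| ≤ δ * |b n|)
    (hc : ∀ n, 1 ≤ n → |c n| ≤ δ * |b n|)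
    (d : ℕ → ℝ)
    (hd0 : d 0 = 1) (hd1 : d 1 = b 1)
    (hd : ∀ n : ℕ, d (n + 2) = b (n + 2) * d (n + 1) - a (n + 2) * c (n + 1) * d n)
    (γ θ η : ℝ) (hγ : γ = 1 / 2 + Real.sqrt (1 / 4 - δ ^ 2)) (hθ : θ = δ / γ)
    (hη : η = 1 / (γ * (1 - θ ^ 2)))
    (m : ℕ) (hm : 1 ≤ m) (sL C₁ : ℝ) (hsL : 0 < sL) (hC₁ : 0 < C₁)
    (hblow : ∀ k : ℕ, C₁ * ((m : ℝ) + k) ^ sL ≤ |b (k + 1)|)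
    (y z : ℕ → ℝ)
    (hz0 : z 0 = y 0)
    (hzk : ∀ k, 1 ≤ k → z k = y k + ∑ l ∈ Finset.Icc 1 k,
      (-1 : ℝ) ^ l * (∏ i ∈ Finset.range l, a (k + 1 - i)) * (d (k - l) / d k) * y (k - l))
    (s : ℝ) (hs : 1 < s)
    (hy : BddAbove (Set.range fun k => |y k| * ((m : ℝ) + k) ^ s)) :
    ∀ k : ℕ, Summable (fun l : ℕ => |Uterm c d z k (l + 1)|) ∧
      Summable (fun i : ℕ => θ ^ (i + 1) * |y (k + 1 + i)| / |b (k + 1 + i + 1)|) ∧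
      |Uinv c d z k| ≤ η * ((∑ j ∈ Finset.range (k + 1), θ ^ (k - j) * |y j| / |b (j + 1)|) +
        ∑' i : ℕ, θ ^ (i + 1) * |y (k + 1 + i)| / |b (k + 1 + i + 1)|) := by
  have hr : Real.sqrt (1 / 4 - δ ^ 2) ^ 2 = 1 / 4 - δ ^ 2 := Real.sq_sqrt (by nlinarith)
  have hr0 := Real.sqrt_nonneg (1 / 4 - δ ^ 2)
  have hγ0 : 0 < γ := by rw [hγ]; linarith
  have hγ1 : γ ≤ 1 := by rw [hγ]; nlinarith
  have hγδ : γ - γ ^ 2 = δ ^ 2 := by rw [hγ]; linear_combination -hr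
  have hθ0 : 0 < θ := by rw [hθ]; positivity
  have hθ1 : θ < 1 := by rw [hθ, div_lt_one hγ0, hγ]; linarith
  have hgrow := continuant_growth hδ0.le hγ0 hγ1 hγδ ha hc hd0 hd1 hd
  have hbpos : ∀ n, 0 < |b (n + 1)| := fun n => abs_pos.mpr (hb _ (by omega))
  have hdpos : ∀ n, 0 < |d n| := by
    intro n
    induction n with
    | zero => simp [hd0]
    | succ n ih => exact (mul_pos (mul_pos hγ0 (hbpos n)) ih).trans_le (hgrow n)
  obtain ⟨M, hM⟩ := hy
  set v : ℕ → ℝ := fun j => |y j| / |b (j + 1)| with hv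
  set w : ℕ → ℝ := fun k => ∑ j ∈ Finset.range (k + 1), θ ^ (k - j) * v j with hw
  have hv0 : ∀ n, 0 ≤ v n := fun n => by positivity
  have hvB : ∀ n, v n ≤ M / C₁ := by
    intro n
    have hmn : (1 : ℝ) ≤ m + n := by exact_mod_cast (by omega : 1 ≤ m + n)
    have hyM : |y n| ≤ M :=
      (le_mul_of_one_le_right (abs_nonneg _) (Real.one_le_rpow hmn (by linarith))).trans
        (hM ⟨n, rfl⟩)
    have hbC : C₁ ≤ |b (n + 1)| :=
      (le_mul_of_one_le_right hC₁.le (Real.one_le_rpow hmn hsL.le)).trans (hblow n)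
    exact div_le_div₀ ((abs_nonneg _).trans hyM) hyM hC₁ hbC
  have hz : ∀ k, |z k| ≤ |b (k + 1)| * w k := by
    intro k
    have hterm : ∀ l ∈ Finset.range (k + 1),
        |(-1 : ℝ) ^ l * (∏ i ∈ Finset.range l, a (k + 1 - i)) * (d (k - l) / d k) * y (k - l)| ≤
          |b (k + 1)| * (θ ^ l * v (k - l)) := by
      intro l hl
      have hP := prod_lower_le hδ0.le hγ0 ha hgrow k l (by simpa [Nat.lt_succ_iff] using hl)
      rw [← hθ] at hP
      have hk := hdpos k
      have hbl := hbpos (k - l)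
      rw [abs_mul, abs_mul, abs_mul, abs_pow, abs_neg, abs_one, one_pow, one_mul,
        Finset.abs_prod, abs_div]
      calc (∏ i ∈ Finset.range l, |a (k + 1 - i)|) * (|d (k - l)| / |d k|) * |y (k - l)|
          = (∏ i ∈ Finset.range l, |a (k + 1 - i)|) * |d (k - l)| * |b (k - l + 1)| *
              (|y (k - l)| / (|d k| * |b (k - l + 1)|)) := by field_simp
        _ ≤ θ ^ l * (|d k| * |b (k + 1)|) * (|y (k - l)| / (|d k| * |b (k - l + 1)|)) := by
            gcongr
        _ = |b (k + 1)| * (θ ^ l * v (k - l)) := by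
            simp only [hv]; field_simp
    have hzsum : z k = ∑ l ∈ Finset.range (k + 1), (-1 : ℝ) ^ l *
        (∏ i ∈ Finset.range l, a (k + 1 - i)) * (d (k - l) / d k) * y (k - l) := by
      rw [Finset.sum_range_succ', Finset.range_eq_Ico, Finset.sum_Ico_add' (fun l => (-1 : ℝ) ^ l *
        (∏ i ∈ Finset.range l, a (k + 1 - i)) * (d (k - l) / d k) * y (k - l)) 0 k 1]
      have hdk : d k ≠ 0 := abs_pos.mp (hdpos k)
      rcases Nat.eq_zero_or_pos k with rfl | hk
      · simp [hz0, hd0]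
      · rw [hzk k hk, add_comm (y k)]
        congr 1
        simp [hdk]
    have hwr : w k = ∑ l ∈ Finset.range (k + 1), θ ^ l * v (k - l) := by
      rw [hw, ← Finset.sum_range_reflect]
      refine Finset.sum_congr rfl fun l hl => ?_
      have hl := Finset.mem_range.mp hl
      rw [show k + 1 - 1 - l = k - l by omega, show k - (k - l) = l by omega]
    rw [hzsum, hwr, Finset.mul_sum]
    exact (Finset.abs_sum_le_sum_abs _ _).trans (Finset.sum_le_sum hterm)
  intro k
  obtain ⟨hV, hW⟩ := hasSum_geometric_of_recurrence hθ0.le hθ1 hv0 hvB (w := w) (by simp [hw])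
    (sum_geometric_weight_succ θ v) k
  have hU : ∀ l, |Uterm c d z k l| ≤ 1 / γ * (θ ^ l * w (k + l)) := by
    intro l
    have hP := prod_upper_le hδ0.le hγ0 hc hgrow k l
    rw [← hθ] at hP
    have hd1 := hdpos (k + l + 1)
    have hb1 := hbpos (k + l)
    have hd0 := hdpos (k + l)
    have hwn : 0 ≤ w (k + l) := Finset.sum_nonneg fun j _ => mul_nonneg (by positivity) (hv0 j)
    rw [Uterm, abs_mul, abs_mul, abs_mul, abs_pow, abs_neg, abs_one, one_pow, one_mul,
      Finset.abs_prod, abs_div]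
    calc |d k| / |d (k + l + 1)| * (∏ i ∈ Finset.range l, |c (k + 1 + i)|) * |z (k + l)|
        = |d k| * (∏ i ∈ Finset.range l, |c (k + 1 + i)|) * |z (k + l)| / |d (k + l + 1)| := by
          ring
      _ ≤ θ ^ l * |d (k + l)| * (|b (k + l + 1)| * w (k + l)) /
            (γ * |b (k + l + 1)| * |d (k + l)|) := by
          gcongr
          · exact hz _
          · exact hgrow _
      _ = 1 / γ * (θ ^ l * w (k + l)) := by field_simp
  have hWγ := hW.mul_left (1 / γ)
  have hUabs : Summable fun l => |Uterm c d z k l| :=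
    Summable.of_nonneg_of_le (fun _ => abs_nonneg _) hU hWγ.summable
  have hUinv : Uinv c d z k = ∑' l, Uterm c d z k l := by
    rw [hUabs.of_abs.tsum_eq_zero_add, Uinv]
    simp [Uterm]
  simp only [mul_div_assoc]
  refine ⟨(summable_nat_add_iff 1).mpr hUabs, hV, ?_⟩
  calc |Uinv c d z k| ≤ 1 / γ * ((w k + ∑' i : ℕ, θ ^ (i + 1) * v (k + 1 + i)) / (1 - θ ^ 2)) := by
        rw [hUinv]
        exact tsum_of_norm_bounded (f := Uterm c d z k) hWγ hU
    _ = η * (w k + ∑' i : ℕ, θ ^ (i + 1) * v (k + 1 + i)) := by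
        rw [hη, one_div, one_div, mul_inv, div_eq_mul_inv]
        ring
end

section
/- Let n ≥ 1 and let (y_k)_{k≥0} be a real sequence with y_k = 0 for all k ≥ n. Then all the series occurring in the definition of G y converge absolutely and: (i) for every 0 ≤ k ≤ n−2, |(G y)_k| ≤ η ( Σ_{l=0}^{k} θ^{k−l} |y_l|/|b_{l+1}| + Σ_{l=k+1}^{n−1} θ^{l−k} |y_l|/|b_{l+1}| ); (ii) for every k ≥ n−1, |(G y)_k| ≤ η θ^k Σ_{l=0}^{n−1} |y_l| / (θ^l |b_{l+1}|). -/
/-- The lower bound on the growth of `d`, where `γ (1 - γ) = δ ^ 2`. -/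
lemma abs_step_le {δ γ : ℝ} (hγ1 : γ ≤ 1) (hγδ : γ * (1 - γ) = δ ^ 2)
    {a b c d : ℕ → ℝ}
    (ha : ∀ n, 2 ≤ n → |a n| ≤ δ * |b n|) (hc : ∀ n, 1 ≤ n → |c n| ≤ δ * |b n|)
    (hd0 : d 0 = 1) (hd1 : d 1 = b 1)
    (hd : ∀ n : ℕ, d (n + 2) = b (n + 2) * d (n + 1) - a (n + 2) * c (n + 1) * d n) (n : ℕ) :
    γ * |b (n + 1)| * |d n| ≤ |d (n + 1)| := by
  induction n with
  | zero =>
    simp only [zero_add, hd0, hd1, abs_one, mul_one]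
    exact mul_le_of_le_one_left (abs_nonneg _) hγ1
  | succ n ih =>
    have hac : |a (n + 2)| * |c (n + 1)| ≤ (δ * |b (n + 2)|) * (δ * |b (n + 1)|) :=
      mul_le_mul (ha _ (by omega)) (hc _ (by omega)) (abs_nonneg _)
        ((abs_nonneg _).trans (ha _ (by omega)))
    have hsub : |b (n + 2)| * |d (n + 1)| - |a (n + 2)| * |c (n + 1)| * |d n| ≤ |d (n + 2)| := by
      have := abs_sub_abs_le_abs_sub (b (n + 2) * d (n + 1)) (a (n + 2) * c (n + 1) * d n)
      rwa [← hd, abs_mul, abs_mul, abs_mul] at this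
    have hprod : |a (n + 2)| * |c (n + 1)| * |d n|
        ≤ (1 - γ) * |b (n + 2)| * |d (n + 1)| := calc
      _ ≤ (δ * |b (n + 2)|) * (δ * |b (n + 1)|) * |d n| := by gcongr
      _ = (1 - γ) * |b (n + 2)| * (γ * |b (n + 1)| * |d n|) := by
        linear_combination (-|b (n + 2)| * |b (n + 1)| * |d n|) * hγδ
      _ ≤ _ := by
        have : 0 ≤ 1 - γ := by linarith
        gcongr
    change γ * |b (n + 2)| * |d (n + 1)| ≤ |d (n + 2)|
    linarith

/-- The bound on the coefficients of `L⁻¹`. -/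
lemma abs_prod_a_le {δ γ θ : ℝ} (hθ0 : 0 ≤ θ) (hδ : δ = θ * γ) {a b d : ℕ → ℝ}
    (ha : ∀ n, 2 ≤ n → |a n| ≤ δ * |b n|)
    (hstep : ∀ n, γ * |b (n + 1)| * |d n| ≤ |d (n + 1)|) (j l : ℕ) :
    |∏ i ∈ Finset.range l, a (j + l + 1 - i)| * |d j| * |b (j + 1)|
      ≤ θ ^ l * |b (j + l + 1)| * |d (j + l)| := by
  induction l with
  | zero => simp [mul_comm]
  | succ l ih =>
    have hshift : ∀ i, j + (l + 1) + 1 - (i + 1) = j + l + 1 - i := by omega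
    rw [Finset.prod_range_succ', abs_mul]
    simp only [hshift, Nat.sub_zero]
    calc _ = |a (j + (l + 1) + 1)| *
          (|∏ i ∈ Finset.range l, a (j + l + 1 - i)| * |d j| * |b (j + 1)|) := by ring
      _ ≤ (δ * |b (j + (l + 1) + 1)|) * (θ ^ l * |b (j + l + 1)| * |d (j + l)|) :=
        mul_le_mul (ha _ (by omega)) ih (by positivity)
          ((abs_nonneg _).trans (ha _ (by omega)))
      _ = θ ^ (l + 1) * |b (j + (l + 1) + 1)| * (γ * |b (j + l + 1)| * |d (j + l)|) := by
        rw [hδ]; ring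
      _ ≤ _ := by gcongr; exact hstep _

/-- The bound on the coefficients of `U⁻¹`. -/
lemma abs_prod_c_le {δ γ θ : ℝ} (hγ0 : 0 < γ) (hθ0 : 0 ≤ θ) (hδ : δ = θ * γ) {b c d : ℕ → ℝ}
    (hc : ∀ n, 1 ≤ n → |c n| ≤ δ * |b n|)
    (hstep : ∀ n, γ * |b (n + 1)| * |d n| ≤ |d (n + 1)|) (k l : ℕ) :
    |d k| * |∏ i ∈ Finset.range l, c (k + 1 + i)| * |b (k + l + 1)| * γ
      ≤ θ ^ l * |d (k + l + 1)| := by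
  induction l with
  | zero => simpa [mul_comm, mul_left_comm] using hstep k
  | succ l ih =>
    have hcl : |c (k + 1 + l)| ≤ δ * |b (k + l + 1)| := by
      rw [add_right_comm]; exact hc _ (by omega)
    rw [Finset.prod_range_succ, abs_mul]
    calc _ = |d k| * |∏ i ∈ Finset.range l, c (k + 1 + i)| * |b (k + (l + 1) + 1)| * γ
          * |c (k + 1 + l)| := by ring
      _ ≤ |d k| * |∏ i ∈ Finset.range l, c (k + 1 + i)| * |b (k + (l + 1) + 1)| * γ
          * (δ * |b (k + l + 1)|) := by gcongr
      _ = (|d k| * |∏ i ∈ Finset.range l, c (k + 1 + i)| * |b (k + l + 1)| * γ)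
          * (θ * γ * |b (k + (l + 1) + 1)|) := by rw [hδ]; ring
      _ ≤ (θ ^ l * |d (k + l + 1)|) * (θ * γ * |b (k + (l + 1) + 1)|) := by gcongr
      _ = θ ^ (l + 1) * (γ * |b (k + (l + 1) + 1)| * |d (k + l + 1)|) := by ring
      _ ≤ _ := by gcongr; exact hstep _

/-- A truncated geometric series, with the truncation exponents in closed form. -/
lemma hasSum_truncated_geometric {θ : ℝ} (hθ0 : 0 ≤ θ) (hθ1 : θ < 1) (j k : ℕ) :
    HasSum (fun l : ℕ => if j ≤ k + l then θ ^ l * θ ^ (k + l - j) else 0)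
      (θ ^ ((k - j) + (j - k)) * (1 - θ ^ 2)⁻¹) := by
  have hgeo := (hasSum_geometric_of_lt_one (sq_nonneg θ)
    (pow_lt_one₀ hθ0 hθ1 two_ne_zero)).mul_left (θ ^ ((k - j) + (j - k)))
  rw [← (add_left_injective (j - k)).hasSum_iff]
  · refine (congrArg (HasSum · _) (funext fun m => ?_)).mpr hgeo
    have hle : j ≤ k + (m + (j - k)) := by omega
    simp only [Function.comp_apply, if_pos hle]
    rw [← pow_mul, ← pow_add, ← pow_add]
    congr 1
    omega
  · intro l hl
    rw [if_neg]
    intro hle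
    exact hl ⟨l - (j - k), by dsimp only; omega⟩

/-- if `y_k = 0` for all `k ≥ n` (with `n ≥ 1`), then all the series in
the definition of `G y = U⁻¹(L⁻¹y)` converge absolutely and
(i) for `0 ≤ k ≤ n−2`, `|(G y)_k| ≤ η (Σ_{l=0}^{k} θ^{k−l} |y_l|/|b_{l+1}|
+ Σ_{l=k+1}^{n−1} θ^{l−k} |y_l|/|b_{l+1}|)`;
(ii) for `k ≥ n−1`, `|(G y)_k| ≤ η θ^k Σ_{l=0}^{n−1} |y_l| / (θ^l |b_{l+1}|)`. -/
theorem statement9 (δ : ℝ) (hδ0 : 0 < δ) (hδ1 : δ < 1 / 2)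
    (a b c : ℕ → ℝ)
    (hb : ∀ n, 1 ≤ n → b n ≠ 0)
    (ha : ∀ n, 2 ≤ n → |a n| ≤ δ * |b n|)
    (hc : ∀ n, 1 ≤ n → |c n| ≤ δ * |b n|)
    (d : ℕ → ℝ)
    (hd0 : d 0 = 1) (hd1 : d 1 = b 1)
    (hd : ∀ n : ℕ, d (n + 2) = b (n + 2) * d (n + 1) - a (n + 2) * c (n + 1) * d n)
    (γ θ η : ℝ) (hγ : γ = 1 / 2 + Real.sqrt (1 / 4 - δ ^ 2)) (hθ : θ = δ / γ)
    (hη : η = 1 / (γ * (1 - θ ^ 2)))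
    (n : ℕ) (hn : 1 ≤ n)
    (y : ℕ → ℝ) (hy : ∀ k, n ≤ k → y k = 0)
    (z : ℕ → ℝ)
    (hz0 : z 0 = y 0)
    (hzk : ∀ k, 1 ≤ k → z k = y k + ∑ l ∈ Finset.Icc 1 k,
      (-1 : ℝ) ^ l * (∏ i ∈ Finset.range l, a (k + 1 - i)) * (d (k - l) / d k) * y (k - l)) :
    (∀ k : ℕ, Summable (fun l : ℕ => |Uterm c d z k (l + 1)|)) ∧
    (∀ k : ℕ, k + 2 ≤ n →
      |Uinv c d z k| ≤ η * ((∑ l ∈ Finset.range (k + 1), θ ^ (k - l) * |y l| / |b (l + 1)|) +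
        ∑ l ∈ Finset.Icc (k + 1) (n - 1), θ ^ (l - k) * |y l| / |b (l + 1)|)) ∧
    (∀ k : ℕ, n ≤ k + 1 →
      |Uinv c d z k| ≤ η * θ ^ k * ∑ l ∈ Finset.range n, |y l| / (θ ^ l * |b (l + 1)|)) := by
  have hs1 : Real.sqrt (1 / 4 - δ ^ 2) ≤ 1 / 2 := by
    rw [Real.sqrt_le_left (by norm_num)]
    nlinarith
  have hs2 : Real.sqrt (1 / 4 - δ ^ 2) ^ 2 = 1 / 4 - δ ^ 2 := Real.sq_sqrt (by nlinarith)
  have hs0 := Real.sqrt_nonneg (1 / 4 - δ ^ 2)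
  have hγ0 : 0 < γ := by linarith
  have hγδ : γ * (1 - γ) = δ ^ 2 := by rw [hγ]; linear_combination -hs2
  have hδθ : δ = θ * γ := by rw [hθ]; field_simp
  have hθ0 : 0 < θ := by rw [hθ]; positivity
  have hθ1 : θ < 1 := by rw [hθ, div_lt_one hγ0]; linarith
  have hstep := abs_step_le (by linarith) hγδ ha hc hd0 hd1 hd
  have hb0 : ∀ m, 0 < |b (m + 1)| := fun m => abs_pos.2 (hb _ (by omega))
  have hdpos : ∀ m, 0 < |d m| := by
    intro m
    induction m with
    | zero => simp [hd0]
    | succ m ih =>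
      have := hb0 m
      exact lt_of_lt_of_le (by positivity) (hstep m)
  have hzsum : ∀ k, z k = ∑ l ∈ Finset.range (k + 1),
      (-1 : ℝ) ^ l * (∏ i ∈ Finset.range l, a (k + 1 - i)) * (d (k - l) / d k) * y (k - l) := by
    intro k
    have hdk : d k ≠ 0 := abs_pos.1 (hdpos k)
    rw [Finset.range_eq_Ico, Finset.sum_eq_sum_Ico_succ_bot (by omega)]
    rcases Nat.eq_zero_or_pos k with rfl | hk
    · simp [hz0, hdk]
    · rw [hzk k hk]
      simp only [Finset.range_zero, Finset.prod_empty, pow_zero, Nat.sub_zero, div_self hdk,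
        one_mul]
      rfl
  have hz : ∀ k, |z k| / |b (k + 1)| ≤
      ∑ j ∈ Finset.range (k + 1), θ ^ (k - j) * (|y j| / |b (j + 1)|) := by
    intro k
    rw [← Finset.sum_range_reflect, div_le_iff₀ (hb0 k), Finset.sum_mul, hzsum]
    refine (Finset.abs_sum_le_sum_abs _ _).trans (Finset.sum_le_sum fun l hl => ?_)
    obtain ⟨j, rfl⟩ : ∃ j, k = j + l := ⟨k - l, by have := Finset.mem_range.1 hl; omega⟩
    have h1 : j + l + 1 - 1 - l = j := by omega
    rw [h1, Nat.add_sub_cancel, Nat.add_sub_cancel_left, abs_mul, abs_mul, abs_mul, abs_pow,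
      abs_neg, abs_one, one_pow, one_mul, abs_div]
    have hbj := hb0 j
    have hdl := hdpos (j + l)
    have hcoef := abs_prod_a_le hθ0.le hδθ ha hstep j l
    calc _ = (|∏ i ∈ Finset.range l, a (j + l + 1 - i)| * |d j| * |b (j + 1)|)
          * (|y j| / (|d (j + l)| * |b (j + 1)|)) := by field_simp
      _ ≤ (θ ^ l * |b (j + l + 1)| * |d (j + l)|)
          * (|y j| / (|d (j + l)| * |b (j + 1)|)) := by gcongr
      _ = _ := by field_simp
  have hU : ∀ k l, |Uterm c d z k l| ≤ γ⁻¹ * ∑ j ∈ Finset.range n,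
      (|y j| / |b (j + 1)|) * if j ≤ k + l then θ ^ l * θ ^ (k + l - j) else 0 := by
    intro k l
    have hbl := hb0 (k + l)
    have hdl := hdpos (k + l + 1)
    have hcoef := abs_prod_c_le hγ0 hθ0.le hδθ hc hstep k l
    have hsum : ∑ j ∈ Finset.range (k + l + 1), θ ^ (k + l - j) * (|y j| / |b (j + 1)|)
        ≤ ∑ j ∈ Finset.range n, (|y j| / |b (j + 1)|) *
          if j ≤ k + l then θ ^ (k + l - j) else 0 := by
      simp only [mul_ite, mul_zero]
      rw [← Finset.sum_filter]
      refine le_of_eq (Finset.sum_subset_zero_on_sdiff ?_ ?_ ?_).symm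
      · intro j hj
        have := (Finset.mem_filter.1 hj).2
        exact Finset.mem_range.2 (by omega)
      · intro j hj
        rw [Finset.mem_sdiff, Finset.mem_filter, Finset.mem_range, Finset.mem_range] at hj
        simp [hy j (by omega)]
      · intro j _
        exact mul_comm _ _
    rw [Uterm, abs_mul, abs_mul, abs_mul, abs_pow, abs_neg, abs_one, one_pow, one_mul, abs_div]
    calc _ = (|d k| * |∏ i ∈ Finset.range l, c (k + 1 + i)| * |b (k + l + 1)| * γ)
          * (γ⁻¹ / |d (k + l + 1)| * (|z (k + l)| / |b (k + l + 1)|)) := by field_simp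
      _ ≤ (θ ^ l * |d (k + l + 1)|)
          * (γ⁻¹ / |d (k + l + 1)| * (|z (k + l)| / |b (k + l + 1)|)) := by gcongr
      _ = γ⁻¹ * (θ ^ l * (|z (k + l)| / |b (k + l + 1)|)) := by field_simp
      _ ≤ γ⁻¹ * (θ ^ l * ∑ j ∈ Finset.range n, (|y j| / |b (j + 1)|) *
          if j ≤ k + l then θ ^ (k + l - j) else 0) := by
        gcongr
        exact (hz _).trans hsum
      _ = _ := by
        rw [Finset.mul_sum]
        congr 1
        refine Finset.sum_congr rfl fun j _ => ?_
        split_ifs <;> ring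
  have hbound : ∀ k, HasSum (fun l => γ⁻¹ * ∑ j ∈ Finset.range n,
      (|y j| / |b (j + 1)|) * if j ≤ k + l then θ ^ l * θ ^ (k + l - j) else 0)
      (γ⁻¹ * ∑ j ∈ Finset.range n,
        (|y j| / |b (j + 1)|) * (θ ^ ((k - j) + (j - k)) * (1 - θ ^ 2)⁻¹)) := fun k =>
    (hasSum_sum fun j _ => (hasSum_truncated_geometric hθ0.le hθ1 j k).mul_left _).mul_left _
  have hsummable : ∀ k, Summable fun l => |Uterm c d z k l| := fun k =>
    .of_nonneg_of_le (fun _ => abs_nonneg _) (hU k) (hbound k).summable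
  have hG : ∀ k, |Uinv c d z k| ≤
      η * ∑ j ∈ Finset.range n, θ ^ ((k - j) + (j - k)) * |y j| / |b (j + 1)| := by
    intro k
    have huinv : Uinv c d z k = ∑' l, Uterm c d z k l := by
      rw [(hsummable k).of_abs.tsum_eq_zero_add]
      simp [Uinv, Uterm]
    rw [huinv]
    refine (tsum_of_norm_bounded (f := Uterm c d z k) (hbound k) (hU k)).trans_eq ?_
    rw [hη, one_div, mul_inv, mul_assoc, Finset.mul_sum (a := (1 - θ ^ 2)⁻¹)]
    congr 1
    exact Finset.sum_congr rfl fun j _ => by ring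
  refine ⟨fun k => (summable_nat_add_iff 1).2 (hsummable k), fun k hk => ?_, fun k hk => ?_⟩
  · refine (hG k).trans_eq ?_
    rw [← Finset.sum_range_add_sum_Ico _ (show k + 1 ≤ n by omega)]
    have hIcc : Finset.Icc (k + 1) (n - 1) = Finset.Ico (k + 1) n := by
      ext j
      rw [Finset.mem_Icc, Finset.mem_Ico]
      omega
    rw [hIcc]
    congr 2
    · refine Finset.sum_congr rfl fun j hj => ?_
      rw [show k - j + (j - k) = k - j by have := Finset.mem_range.1 hj; omega]
    · refine Finset.sum_congr rfl fun j hj => ?_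
      rw [show k - j + (j - k) = j - k by have := Finset.mem_Ico.1 hj; omega]
  · refine (hG k).trans_eq ?_
    rw [mul_assoc, Finset.mul_sum (a := θ ^ k)]
    congr 1
    refine Finset.sum_congr rfl fun j hj => ?_
    have hjk : j ≤ k := by have := Finset.mem_range.1 hj; omega
    rw [Nat.sub_eq_zero_of_le hjk, add_zero, pow_sub₀ _ hθ0.ne' hjk]
    have hbj := hb0 j
    field_simp
end

section
/- Let θ ∈ (0,1), let m ≥ 2 be an integer, let p > 0 be a real number, and let M be an integer with M ≥ max( (−m ln√θ − p − 1 − √((m ln√θ + p + 1)² − 4 m ln√θ)) / (2 ln√θ), 4/(ln θ)², m ). Then for every integer k ≥ M, Σ_{l=0}^{k} θ^{k−l} ((m+k)/(m+l))^p ≤ θ^{M/2} (M/2) ((m+M)/m)^p + θ^{√M} (M/2) 2^p + (1/(1−θ)) ((m+M)/(m+M−√M−1))^p. -/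
/-- Above the larger root, the concave quadratic governing the first summand is nonpositive. -/
lemma quadratic_nonpos_of_root_le {a b c x : ℝ} (ha : a < 0) (hD : 0 ≤ b ^ 2 - 4 * a * c)
    (hx : (-b - Real.sqrt (b ^ 2 - 4 * a * c)) / (2 * a) ≤ x) :
    a * x ^ 2 + b * x + c ≤ 0 := by
  rw [div_le_iff_of_neg (by linarith)] at hx
  have hs := Real.sq_sqrt hD
  have hs0 := Real.sqrt_nonneg (b ^ 2 - 4 * a * c)
  by_contra! h
  nlinarith [mul_neg_of_neg_of_pos ha h]

/-- `x ↦ θ ^ (x / 2) * (x / 2) * ((m + x) / m) ^ p` decreases from `x` on, once its logarithmic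
derivative at `x` is nonpositive. -/
lemma rpow_half_mul_le {θ m p x y : ℝ} (hθ : 0 < θ) (hm : 0 < m) (hp : 0 ≤ p) (hx : 0 < x)
    (hxy : x ≤ y)
    (h : Real.log θ / 2 * x ^ 2 + (m * (Real.log θ / 2) + p + 1) * x + m ≤ 0) :
    θ ^ (y / 2) * (y / 2) * ((m + y) / m) ^ p ≤ θ ^ (x / 2) * (x / 2) * ((m + x) / m) ^ p := by
  have hy : 0 < y := hx.trans_le hxy
  have hslope : Real.log θ / 2 + 1 / x + p / (m + x) ≤ 0 := by
    have : Real.log θ / 2 + 1 / x + p / (m + x) =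
        (Real.log θ / 2 * x ^ 2 + (m * (Real.log θ / 2) + p + 1) * x + m) / (x * (m + x)) := by
      field_simp
      ring
    rw [this]
    exact div_nonpos_of_nonpos_of_nonneg h (by positivity)
  have h1 := Real.log_le_sub_one_of_pos (div_pos hy hx)
  have h2 := Real.log_le_sub_one_of_pos (div_pos (add_pos hm hy) (add_pos hm hx))
  rw [Real.log_div hy.ne' hx.ne'] at h1
  rw [Real.log_div (by positivity) (by positivity)] at h2
  have e1 : y / x - 1 = (y - x) * (1 / x) := by field_simp
  have e2 : p * ((m + y) / (m + x) - 1) = (y - x) * (p / (m + x)) := by field_simp; ring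
  have h3 := mul_le_mul_of_nonneg_left h2 hp
  have h4 := mul_nonpos_of_nonneg_of_nonpos (sub_nonneg.2 hxy) hslope
  have key : ∀ z : ℝ, 0 < z → Real.log (θ ^ (z / 2) * (z / 2) * ((m + z) / m) ^ p) =
      z / 2 * Real.log θ + (Real.log z - Real.log 2) +
        p * (Real.log (m + z) - Real.log m) := by
    intro z hz
    rw [Real.log_mul (by positivity) (by positivity), Real.log_mul (by positivity) (by positivity),
      Real.log_rpow hθ, Real.log_rpow (by positivity), Real.log_div hz.ne' (by norm_num),
      Real.log_div (by positivity) hm.ne']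
  rw [← Real.log_le_log_iff (by positivity) (by positivity), key y hy, key x hx]
  linarith

/-- `x ↦ θ ^ √x * (x / 2)` decreases from `4 / (log θ) ^ 2` on. -/
lemma rpow_sqrt_mul_le {θ x y : ℝ} (hθ : 0 < θ) (hθ1 : θ < 1) (hx : 0 < x) (hxy : x ≤ y)
    (h : 4 / Real.log θ ^ 2 ≤ x) :
    θ ^ Real.sqrt y * (y / 2) ≤ θ ^ Real.sqrt x * (x / 2) := by
  have hy : 0 < y := hx.trans_le hxy
  have hlog : Real.log θ < 0 := Real.log_neg hθ hθ1
  have hsx : 0 < Real.sqrt x := Real.sqrt_pos.2 hx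
  have hsy : 0 < Real.sqrt y := Real.sqrt_pos.2 hy
  have hs : Real.sqrt x ≤ Real.sqrt y := Real.sqrt_le_sqrt hxy
  have h2 : 2 ≤ -Real.log θ * Real.sqrt x := by
    rw [div_le_iff₀ (sq_pos_of_neg hlog)] at h
    refine le_of_sq_le_sq ?_ (mul_nonneg (by linarith) hsx.le)
    rw [mul_pow, Real.sq_sqrt hx.le]
    linarith
  have h1 := Real.log_le_sub_one_of_pos (div_pos hsy hsx)
  rw [Real.log_div hsy.ne' hsx.ne', Real.log_sqrt hy.le, Real.log_sqrt hx.le] at h1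
  have h3 : 2 * (Real.sqrt y / Real.sqrt x - 1) ≤
      -Real.log θ * (Real.sqrt y - Real.sqrt x) := by
    have : 2 * (Real.sqrt y / Real.sqrt x - 1) = 2 / Real.sqrt x * (Real.sqrt y - Real.sqrt x) := by
      field_simp
    rw [this]
    exact mul_le_mul_of_nonneg_right ((div_le_iff₀ hsx).2 h2) (sub_nonneg.2 hs)
  rw [← Real.log_le_log_iff (by positivity) (by positivity),
    Real.log_mul (by positivity) (by positivity), Real.log_mul (by positivity) (by positivity),
    Real.log_rpow hθ, Real.log_rpow hθ, Real.log_div hy.ne' (by norm_num),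
    Real.log_div hx.ne' (by norm_num)]
  linarith

/-- The denominator of the last summand is positive. -/
lemma sub_sqrt_sub_one_pos {m x : ℝ} (hm : 1 < m) (hx : 1 ≤ x) :
    0 < m + x - Real.sqrt x - 1 := by
  have : Real.sqrt x ≤ x := Real.sqrt_le_iff.2 ⟨by linarith, by nlinarith⟩
  linarith

/-- `x ↦ (m + x) / (m + x - √x - 1)` decreases from `m` on. -/
lemma div_sub_sqrt_le {m x y : ℝ} (hm : 1 < m) (hx : m ≤ x) (hxy : x ≤ y) :
    (m + y) / (m + y - Real.sqrt y - 1) ≤ (m + x) / (m + x - Real.sqrt x - 1) := by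
  rw [div_le_div_iff₀ (sub_sqrt_sub_one_pos hm (by linarith))
    (sub_sqrt_sub_one_pos hm (by linarith))]
  have hs : Real.sqrt x ≤ Real.sqrt y := Real.sqrt_le_sqrt hxy
  have hs0 := Real.sqrt_nonneg x
  have hsx := Real.sq_sqrt (show 0 ≤ x by linarith)
  have hsy := Real.sq_sqrt (show 0 ≤ y by linarith)
  generalize Real.sqrt x = s at *
  generalize Real.sqrt y = t at *
  subst hsx hsy
  have : 0 ≤ (t - s) * (s * t - m + t + s) :=
    mul_nonneg (sub_nonneg.2 hs) (by nlinarith)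
  nlinarith

/-- The terms with `l < k / 2`, those with `k / 2 ≤ l < k - √k - 1` and the last ones are bounded
by the three respective summands. -/
lemma term_le {θ m p : ℝ} (hθ : 0 < θ) (hθ1 : θ < 1) (hm : 1 < m) (hp : 0 ≤ p) {k l : ℕ}
    (hk : 1 ≤ k) (hl : l ≤ k) :
    θ ^ (k - l) * ((m + k) / (m + l)) ^ p ≤
      (if l ∈ Finset.range (k / 2) then θ ^ ((k : ℝ) / 2) * ((m + k) / m) ^ p else 0) +
      (if l ∈ Finset.Ico (k / 2) (k - 1) then θ ^ Real.sqrt k * (2 : ℝ) ^ p else 0) +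
      θ ^ (k - l) * ((m + k) / (m + k - Real.sqrt k - 1)) ^ p := by
  have hkR : (1 : ℝ) ≤ k := by exact_mod_cast hk
  have hd := sub_sqrt_sub_one_pos hm hkR
  have hcast : θ ^ (k - l) = θ ^ ((k : ℝ) - l) := by
    rw [← Nat.cast_sub hl, Real.rpow_natCast]
  have hA : 0 ≤ if l ∈ Finset.range (k / 2) then θ ^ ((k : ℝ) / 2) * ((m + k) / m) ^ p else 0 := by
    split_ifs <;> positivity
  have hB : 0 ≤ if l ∈ Finset.Ico (k / 2) (k - 1) then θ ^ Real.sqrt k * (2 : ℝ) ^ p else 0 := by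
    split_ifs <;> positivity
  have hC : 0 ≤ θ ^ (k - l) * ((m + k) / (m + k - Real.sqrt k - 1)) ^ p := by positivity
  by_cases h1 : l < k / 2
  · have hlk : 2 * (l : ℝ) ≤ k := by exact_mod_cast (by omega : 2 * l ≤ k)
    have : θ ^ (k - l) * ((m + k) / (m + l)) ^ p ≤ θ ^ ((k : ℝ) / 2) * ((m + k) / m) ^ p := by
      rw [hcast]
      gcongr ?_ * (_ / ?_) ^ p
      · exact Real.rpow_le_rpow_of_exponent_ge hθ hθ1.le (by linarith)
      · simp
    rw [if_pos (Finset.mem_range.2 h1)]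
    linarith
  have hlk : (k : ℝ) ≤ 2 * l + 1 := by exact_mod_cast (by omega : k ≤ 2 * l + 1)
  by_cases h2 : (l : ℝ) < k - Real.sqrt k - 1
  · have hs : 1 ≤ Real.sqrt k := Real.one_le_sqrt.2 hkR
    have hl2 : l < k - 1 := by
      have : (l : ℝ) + 1 < k := by linarith
      have : l + 1 < k := by exact_mod_cast this
      omega
    have : θ ^ (k - l) * ((m + k) / (m + l)) ^ p ≤ θ ^ Real.sqrt k * (2 : ℝ) ^ p := by
      rw [hcast]
      gcongr ?_ * ?_ ^ p
      · exact Real.rpow_le_rpow_of_exponent_ge hθ hθ1.le (by linarith)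
      · rw [div_le_iff₀ (by positivity)]
        linarith
    rw [if_pos (Finset.mem_Ico.2 ⟨by omega, hl2⟩)]
    linarith
  · have : θ ^ (k - l) * ((m + k) / (m + l)) ^ p ≤
        θ ^ (k - l) * ((m + k) / (m + k - Real.sqrt k - 1)) ^ p := by
      gcongr ?_ * (_ / ?_) ^ p
      linarith
    linarith

/-- The bound with `M = k`, valid for every `k ≥ 1`. -/
lemma sum_le_at_self {θ m p : ℝ} (hθ : 0 < θ) (hθ1 : θ < 1) (hm : 1 < m) (hp : 0 ≤ p) {k : ℕ}
    (hk : 1 ≤ k) :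
    ∑ l ∈ Finset.range (k + 1), θ ^ (k - l) * ((m + k) / (m + l)) ^ p ≤
      θ ^ ((k : ℝ) / 2) * ((k : ℝ) / 2) * ((m + k) / m) ^ p +
      θ ^ Real.sqrt k * ((k : ℝ) / 2) * (2 : ℝ) ^ p +
      1 / (1 - θ) * ((m + k) / (m + k - Real.sqrt k - 1)) ^ p := by
  have hd := sub_sqrt_sub_one_pos hm (show (1 : ℝ) ≤ k by exact_mod_cast hk)
  have hcount : ∀ (t : Finset ℕ) (c : ℝ), 0 ≤ c → t.card ≤ k / 2 →
      ∑ l ∈ Finset.range (k + 1), (if l ∈ t then c else 0) ≤ (k : ℝ) / 2 * c := by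
    intro t c hc ht
    rw [Finset.sum_ite_mem, Finset.sum_const, nsmul_eq_mul]
    refine mul_le_mul_of_nonneg_right ?_ hc
    have h : (Finset.range (k + 1) ∩ t).card ≤ k / 2 :=
      (Finset.card_le_card Finset.inter_subset_right).trans ht
    exact (Nat.cast_le.2 h).trans Nat.cast_div_le
  have hgeom : ∑ l ∈ Finset.range (k + 1), θ ^ (k - l) ≤ 1 / (1 - θ) := by
    have hrefl := Finset.sum_range_reflect (fun i => θ ^ i) (k + 1)
    simp only [Nat.add_sub_cancel] at hrefl
    rw [hrefl, one_div, ← tsum_geometric_of_lt_one hθ.le hθ1]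
    exact (summable_geometric_of_lt_one hθ.le hθ1).sum_le_tsum _ fun i _ => by positivity
  refine (Finset.sum_le_sum fun l hl =>
    term_le hθ hθ1 hm hp hk (Nat.lt_succ_iff.1 (Finset.mem_range.1 hl))).trans ?_
  rw [Finset.sum_add_distrib, Finset.sum_add_distrib, ← Finset.sum_mul]
  have hA := hcount (Finset.range (k / 2)) (θ ^ ((k : ℝ) / 2) * ((m + k) / m) ^ p)
    (by positivity) (by simp)
  have hB := hcount (Finset.Ico (k / 2) (k - 1)) (θ ^ Real.sqrt k * (2 : ℝ) ^ p)
    (by positivity) (by rw [Nat.card_Ico]; omega)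
  have hC := mul_le_mul_of_nonneg_right hgeom
    (show 0 ≤ ((m + k) / (m + k - Real.sqrt k - 1)) ^ p by positivity)
  linarith

/-- for `θ ∈ (0,1)`, an integer `m ≥ 2`, `p > 0` and an integer `M`
large enough, for every integer `k ≥ M`,
`Σ_{l=0}^{k} θ^{k−l} ((m+k)/(m+l))^p ≤ θ^{M/2} (M/2) ((m+M)/m)^p
+ θ^{√M} (M/2) 2^p + (1/(1−θ)) ((m+M)/(m+M−√M−1))^p`. -/
theorem statement12 (θ : ℝ) (hθ0 : 0 < θ) (hθ1 : θ < 1)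
    (m : ℕ) (hm : 2 ≤ m) (p : ℝ) (hp : 0 < p) (M : ℕ)
    (hM : (M : ℝ) ≥ max (max
      ((-(m : ℝ) * Real.log (Real.sqrt θ) - p - 1 -
          Real.sqrt (((m : ℝ) * Real.log (Real.sqrt θ) + p + 1) ^ 2 -
            4 * (m : ℝ) * Real.log (Real.sqrt θ))) / (2 * Real.log (Real.sqrt θ)))
      (4 / (Real.log θ) ^ 2)) (m : ℝ)) :
    ∀ k : ℕ, M ≤ k →
      ∑ l ∈ Finset.range (k + 1), θ ^ (k - l) * (((m : ℝ) + k) / ((m : ℝ) + l)) ^ p ≤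
        θ ^ ((M : ℝ) / 2) * ((M : ℝ) / 2) * (((m : ℝ) + M) / m) ^ p +
        θ ^ Real.sqrt M * ((M : ℝ) / 2) * (2 : ℝ) ^ p +
        1 / (1 - θ) * (((m : ℝ) + M) / ((m : ℝ) + M - Real.sqrt M - 1)) ^ p := by
  intro k hk
  obtain ⟨hM', hMm⟩ := max_le_iff.1 hM
  obtain ⟨hM1, hM2⟩ := max_le_iff.1 hM'
  have hmR : (2 : ℝ) ≤ m := by exact_mod_cast hm
  have hkR : (M : ℝ) ≤ k := by exact_mod_cast hk
  have hM0 : (0 : ℝ) < M := by linarith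
  have hk1 : 1 ≤ k := by
    have : (1 : ℝ) ≤ k := by linarith
    exact_mod_cast this
  have hlog : Real.log θ < 0 := Real.log_neg hθ0 hθ1
  rw [Real.log_sqrt hθ0.le] at hM1
  have hquad : Real.log θ / 2 * (M : ℝ) ^ 2 +
      ((m : ℝ) * (Real.log θ / 2) + p + 1) * M + m ≤ 0 := by
    refine quadratic_nonpos_of_root_le (by linarith) ?_ (le_trans (le_of_eq ?_) hM1)
    · nlinarith [sq_nonneg ((m : ℝ) * (Real.log θ / 2) + p + 1)]
    · ring_nf
  have hd := sub_sqrt_sub_one_pos (m := (m : ℝ)) (x := k) (by linarith) (by linarith)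
  refine (sum_le_at_self hθ0 hθ1 (by linarith) hp.le hk1).trans ?_
  have h1 : (0 : ℝ) ≤ 1 / (1 - θ) := one_div_nonneg.2 (by linarith)
  gcongr ?_ + ?_ * _ + _ * ?_ ^ p
  · exact rpow_half_mul_le hθ0 (by linarith) hp.le hM0 hkR hquad
  · exact rpow_sqrt_mul_le hθ0 hθ1 hM0 hkR hM2
  · exact div_sub_sqrt_le (by linarith) hMm hkR
end

section
/- For every integer L ≥ 1, the series Σ_{l=1}^{∞} (c_1⋯c_l)(a_2⋯a_{l+1}) / (δ_l δ_{l+1}) converges absolutely and Σ_{l=L}^{∞} |c_1⋯c_l| |a_2⋯a_{l+1}| / (|δ_l| |δ_{l+1}|) ≤ θ^{2L} / (|b_1| (1 − θ²)). -/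
/-- The general term (index `l ≥ 1`) of the series
`Σ_{l=1}^{∞} (c_1⋯c_l)(a_2⋯a_{l+1}) / (δ_l δ_{l+1})`. -/
noncomputable def wSeriesTerm (a c d : ℕ → ℝ) (l : ℕ) : ℝ :=
  (∏ i ∈ Finset.Icc 1 l, c i) * (∏ i ∈ Finset.Icc 2 (l + 1), a i) / (d l * d (l + 1))

/-- Solutions of the three-term recurrence grow at least by the factor `γ * |b (n + 1)|`, where
`γ` is a fixed point of `x ↦ 1 - δ ^ 2 / x`. -/
theorem mul_abs_le_abs_succ_of_recurrence {δ γ : ℝ} (hδ : 0 ≤ δ) (hγ1 : γ ≤ 1)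
    (hγ : γ - γ ^ 2 = δ ^ 2) {a b c d : ℕ → ℝ}
    (ha : ∀ n, 2 ≤ n → |a n| ≤ δ * |b n|) (hc : ∀ n, 1 ≤ n → |c n| ≤ δ * |b n|)
    (hd0 : d 0 = 1) (hd1 : d 1 = b 1)
    (hd : ∀ n : ℕ, d (n + 2) = b (n + 2) * d (n + 1) - a (n + 2) * c (n + 1) * d n) (n : ℕ) :
    γ * |b (n + 1)| * |d n| ≤ |d (n + 1)| := by
  induction n with
  | zero =>
    simpa [hd0, hd1] using mul_le_of_le_one_left (abs_nonneg (b 1)) hγ1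
  | succ n ih =>
    have hac : |a (n + 2)| * |c (n + 1)| ≤ (δ * |b (n + 2)|) * (δ * |b (n + 1)|) :=
      mul_le_mul (ha _ (by lia)) (hc _ (by lia)) (abs_nonneg _) (by positivity)
    have hsub : |b (n + 2)| * |d (n + 1)| - |a (n + 2)| * |c (n + 1)| * |d n|
        ≤ |d (n + 2)| := by
      rw [hd, ← abs_mul, ← abs_mul, ← abs_mul]
      exact abs_sub_abs_le_abs_sub _ _
    have hprod : |a (n + 2)| * |c (n + 1)| * |d n| ≤ (1 - γ) * |b (n + 2)| * |d (n + 1)| :=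
      calc |a (n + 2)| * |c (n + 1)| * |d n|
          ≤ (δ * |b (n + 2)|) * (δ * |b (n + 1)|) * |d n| := by gcongr
        _ = (1 - γ) * |b (n + 2)| * (γ * |b (n + 1)| * |d n|) := by
            linear_combination (-|b (n + 2)| * |b (n + 1)| * |d n|) * hγ
        _ ≤ (1 - γ) * |b (n + 2)| * |d (n + 1)| :=
            mul_le_mul_of_nonneg_left ih (mul_nonneg (by linarith) (abs_nonneg _))
    linarith

/-- If `d` grows at least by the factor `γ * |b (n + 1)|`, then the terms of the series decay
geometrically with ratio `θ ^ 2`, where `θ * γ = δ`. -/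
theorem abs_wSeriesTerm_le {δ γ θ : ℝ} (hγ : 0 < γ) (hθ : 0 ≤ θ) (hθγ : θ * γ = δ)
    {a b c d : ℕ → ℝ} (hb : ∀ n, 1 ≤ n → b n ≠ 0)
    (ha : ∀ n, 2 ≤ n → |a n| ≤ δ * |b n|) (hc : ∀ n, 1 ≤ n → |c n| ≤ δ * |b n|)
    (hd0 : d 0 = 1) (hd1 : d 1 = b 1)
    (hgrow : ∀ n, γ * |b (n + 1)| * |d n| ≤ |d (n + 1)|) (l : ℕ) :
    |wSeriesTerm a c d l| ≤ (θ ^ 2) ^ l / |b 1| := by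
  have hpos : ∀ n, 0 < |d n| := by
    intro n
    induction n with
    | zero => simp [hd0]
    | succ n ih =>
      have := abs_pos.2 (hb (n + 1) (by lia))
      exact (by positivity : 0 < γ * |b (n + 1)| * |d n|).trans_le (hgrow n)
  have hstep : ∀ (n k : ℕ), θ ^ k * |d n| * (δ * |b (n + 1)|) ≤ θ ^ (k + 1) * |d (n + 1)| := by
    intro n k
    calc θ ^ k * |d n| * (δ * |b (n + 1)|)
        = θ ^ (k + 1) * (γ * |b (n + 1)| * |d n|) := by rw [← hθγ]; ring
      _ ≤ θ ^ (k + 1) * |d (n + 1)| := by gcongr; exact hgrow n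
  have hprodc : |∏ i ∈ Finset.Icc 1 l, c i| ≤ θ ^ l * |d l| := by
    induction l with
    | zero => simp [hd0]
    | succ l ih =>
      rw [Finset.prod_Icc_succ_top (by lia), abs_mul]
      exact (mul_le_mul ih (hc _ (by lia)) (abs_nonneg _) (by positivity)).trans (hstep l l)
  have hproda : |b 1| * |∏ i ∈ Finset.Icc 2 (l + 1), a i| ≤ θ ^ l * |d (l + 1)| := by
    clear hprodc
    induction l with
    | zero => simp [hd1]
    | succ l ih =>
      rw [Finset.prod_Icc_succ_top (by lia), abs_mul, ← mul_assoc]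
      exact (mul_le_mul ih (ha _ (by lia)) (abs_nonneg _) (by positivity)).trans
        (hstep (l + 1) l)
  have hb1 : 0 < |b 1| := abs_pos.2 (hb 1 le_rfl)
  have hl := hpos l
  have hl' := hpos (l + 1)
  rw [wSeriesTerm, abs_div, abs_mul, abs_mul, div_le_div_iff₀ (by positivity) hb1]
  calc |∏ i ∈ Finset.Icc 1 l, c i| * |∏ i ∈ Finset.Icc 2 (l + 1), a i| * |b 1|
      = |∏ i ∈ Finset.Icc 1 l, c i| * (|b 1| * |∏ i ∈ Finset.Icc 2 (l + 1), a i|) := by ring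
    _ ≤ (θ ^ l * |d l|) * (θ ^ l * |d (l + 1)|) := by gcongr
    _ = (θ ^ 2) ^ l * (|d l| * |d (l + 1)|) := by ring

/-- the series `Σ_{l=1}^{∞} (c_1⋯c_l)(a_2⋯a_{l+1})/(δ_l δ_{l+1})`
converges absolutely, and for every `L ≥ 1` the tail satisfies
`Σ_{l=L}^{∞} |c_1⋯c_l| |a_2⋯a_{l+1}| / (|δ_l| |δ_{l+1}|) ≤ θ^{2L} / (|b_1| (1−θ²))`. -/
theorem statement16 (δ : ℝ) (hδ0 : 0 < δ) (hδ1 : δ < 1 / 2)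
    (a b c : ℕ → ℝ)
    (hb : ∀ n, 1 ≤ n → b n ≠ 0)
    (ha : ∀ n, 2 ≤ n → |a n| ≤ δ * |b n|)
    (hc : ∀ n, 1 ≤ n → |c n| ≤ δ * |b n|)
    (d : ℕ → ℝ)
    (hd0 : d 0 = 1) (hd1 : d 1 = b 1)
    (hd : ∀ n : ℕ, d (n + 2) = b (n + 2) * d (n + 1) - a (n + 2) * c (n + 1) * d n)
    (γ θ : ℝ) (hγ : γ = 1 / 2 + Real.sqrt (1 / 4 - δ ^ 2)) (hθ : θ = δ / γ) :
    ∀ L : ℕ, 1 ≤ L →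
      Summable (fun l : ℕ => |wSeriesTerm a c d (l + 1)|) ∧
      (∑' i : ℕ, |wSeriesTerm a c d (L + i)|) ≤ θ ^ (2 * L) / (|b 1| * (1 - θ ^ 2)) := by
  have hs := Real.sqrt_nonneg (1 / 4 - δ ^ 2)
  have hsq : Real.sqrt (1 / 4 - δ ^ 2) ^ 2 = 1 / 4 - δ ^ 2 := Real.sq_sqrt (by nlinarith)
  have hγ0 : 0 < γ := by linarith
  have hγ1 : γ ≤ 1 := by nlinarith
  have hγ2 : γ - γ ^ 2 = δ ^ 2 := by rw [hγ]; linear_combination -hsq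
  have hθ0 : 0 ≤ θ := by rw [hθ]; positivity
  have hθ1 : θ < 1 := by rw [hθ, div_lt_one hγ0]; linarith
  have hθsq : θ ^ 2 < 1 := pow_lt_one₀ hθ0 hθ1 two_ne_zero
  have hle := abs_wSeriesTerm_le hγ0 hθ0 (by rw [hθ]; field_simp) hb ha hc hd0 hd1
    (mul_abs_le_abs_succ_of_recurrence hδ0.le hγ1 hγ2 ha hc hd0 hd1 hd)
  have hsum : Summable fun l => |wSeriesTerm a c d l| :=
    .of_nonneg_of_le (fun _ => abs_nonneg _) hle
      ((summable_geometric_of_lt_one (sq_nonneg θ) hθsq).div_const _)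
  intro L _
  have hgeom : HasSum (fun i => (θ ^ 2) ^ (L + i) / |b 1|)
      (θ ^ (2 * L) / (|b 1| * (1 - θ ^ 2))) := by
    have h := (hasSum_geometric_of_lt_one (sq_nonneg θ) hθsq).mul_left (θ ^ (2 * L) / |b 1|)
    rw [← div_eq_mul_inv, div_div] at h
    convert! h using 2 with i
    ring
  refine ⟨(summable_nat_add_iff 1).2 hsum, ?_⟩
  exact (hsum.comp_injective (add_right_injective L)).tsum_le_of_sum_le fun s =>
    (Finset.sum_le_sum fun i _ => hle (L + i)).trans
      (sum_le_hasSum s (fun i _ => by positivity) hgeom)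
end

section
/- Let s > 1. For every y ∈ Ω^s, all the series occurring in the definition of x = A y converge absolutely, and x ∈ Ω^{s+s_L}, i.e. sup_{k≥0} |x_k| ω_k^{s+s_L} < ∞. (In other words, the operator A maps Ω^s into Ω^{s+s_L}.) -/
/-- The weights `ω_k^s`: `ω_0^s = 1` and `ω_k^s = k^s` for `k ≥ 1`. -/
noncomputable def wgt (s : ℝ) (k : ℕ) : ℝ := if k = 0 then 1 else (k : ℝ) ^ s

/-- The sequence `e₀ = (1, 0, 0, …)`. -/
def e₀ : ℕ → ℝ := fun k => if k = 0 then 1 else 0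

/-- Lower bound for the growth of the leading principal minors of a diagonally dominant
tridiagonal matrix. -/
theorem minor_lower_bound {δ γ : ℝ} {a b c d : ℕ → ℝ} (hδ0 : 0 ≤ δ) (hγ1 : γ ≤ 1)
    (hγ : γ - γ ^ 2 = δ ^ 2)
    (ha : ∀ n, 2 ≤ n → |a n| ≤ δ * |b n|) (hc : ∀ n, 1 ≤ n → |c n| ≤ δ * |b n|)
    (hd0 : d 0 = 1) (hd1 : d 1 = b 1)
    (hd : ∀ n : ℕ, d (n + 2) = b (n + 2) * d (n + 1) - a (n + 2) * c (n + 1) * d n) (n : ℕ) :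
    γ * |b (n + 1)| * |d n| ≤ |d (n + 1)| := by
  induction n with
  | zero =>
    simp only [zero_add, hd0, hd1, abs_one, mul_one]
    nlinarith [abs_nonneg (b 1)]
  | succ n ih =>
    rw [hd n]
    have h1 : |a (n + 2) * c (n + 1) * d n| ≤
        δ * |b (n + 2)| * (δ * |b (n + 1)|) * |d n| := by
      rw [abs_mul, abs_mul]
      gcongr
      · exact ha _ (by omega)
      · exact hc _ (by omega)
    have h2 := abs_sub_abs_le_abs_sub (b (n + 2) * d (n + 1)) (a (n + 2) * c (n + 1) * d n)
    rw [abs_mul (b (n + 2))] at h2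
    have h3 : δ * |b (n + 2)| * (δ * |b (n + 1)|) * |d n| ≤
        (1 - γ) * |b (n + 2)| * |d (n + 1)| := by
      have h4 : δ * |b (n + 2)| * (δ * |b (n + 1)|) * |d n| =
          (1 - γ) * |b (n + 2)| * (γ * |b (n + 1)| * |d n|) := by
        linear_combination (-(|b (n + 2)| * |b (n + 1)| * |d n|)) * hγ
      rw [h4]
      have : 0 ≤ 1 - γ := by linarith
      gcongr
    show γ * |b (n + 2)| * |d (n + 1)| ≤ _
    linarith

theorem prod_upper_mul_minor_le {δ γ : ℝ} {b c d : ℕ → ℝ} (hδ0 : 0 ≤ δ) (hγ0 : 0 ≤ γ)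
    (hc : ∀ n, 1 ≤ n → |c n| ≤ δ * |b n|)
    (hd : ∀ n, γ * |b (n + 1)| * |d n| ≤ |d (n + 1)|) (k l : ℕ) :
    (∏ i ∈ Finset.range l, |c (k + 1 + i)|) * |d k| * γ ^ l ≤ δ ^ l * |d (k + l)| := by
  induction l with
  | zero => simp
  | succ l ih =>
    rw [Finset.prod_range_succ]
    calc _ = ((∏ i ∈ Finset.range l, |c (k + 1 + i)|) * |d k| * γ ^ l) *
          (γ * |c (k + 1 + l)|) := by ring
      _ ≤ (δ ^ l * |d (k + l)|) * (γ * (δ * |b (k + 1 + l)|)) := by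
          gcongr
          exact hc _ (by omega)
      _ = δ ^ (l + 1) * (γ * |b (k + l + 1)| * |d (k + l)|) := by
          rw [show k + 1 + l = k + l + 1 by omega]; ring
      _ ≤ _ := by gcongr; exact hd _

theorem prod_lower_mul_minor_le {δ γ : ℝ} {a b d : ℕ → ℝ} (hδ0 : 0 ≤ δ) (hγ0 : 0 ≤ γ)
    (ha : ∀ n, 2 ≤ n → |a n| ≤ δ * |b n|)
    (hd : ∀ n, γ * |b (n + 1)| * |d n| ≤ |d (n + 1)|) (j l : ℕ) :
    (∏ i ∈ Finset.range l, |a (j + l + 1 - i)|) * |d j| * |b (j + 1)| * γ ^ l ≤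
      δ ^ l * |b (j + l + 1)| * |d (j + l)| := by
  induction l with
  | zero => simp [mul_comm]
  | succ l ih =>
    rw [Finset.prod_range_succ']
    have hp : ∏ i ∈ Finset.range l, |a (j + (l + 1) + 1 - (i + 1))| =
        ∏ i ∈ Finset.range l, |a (j + l + 1 - i)| :=
      Finset.prod_congr rfl fun i _ => by
        rw [show j + (l + 1) + 1 - (i + 1) = j + l + 1 - i by omega]
    rw [hp]
    calc _ = ((∏ i ∈ Finset.range l, |a (j + l + 1 - i)|) * |d j| * |b (j + 1)| * γ ^ l) *
          (γ * |a (j + (l + 1) + 1)|) := by simp only [Nat.sub_zero]; ring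
      _ ≤ (δ ^ l * |b (j + l + 1)| * |d (j + l)|) * (γ * (δ * |b (j + (l + 1) + 1)|)) := by
          gcongr
          exact ha _ (by omega)
      _ = δ ^ (l + 1) * |b (j + (l + 1) + 1)| * (γ * |b (j + l + 1)| * |d (j + l)|) := by ring
      _ ≤ _ := by gcongr; exact hd _

theorem summable_geometric_mul_rpow {r : ℝ} (hr0 : 0 < r) (hr1 : r < 1) (t : ℝ) :
    Summable fun l : ℕ => r ^ l * ((1 : ℝ) + l) ^ t := by
  obtain ⟨N, hN⟩ := exists_nat_ge t
  have h1 := summable_pow_mul_geometric_of_norm_lt_one N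
    (r := r) (by rwa [Real.norm_of_nonneg hr0.le])
  have h2 := ((summable_nat_add_iff 1).2 h1).mul_left r⁻¹
  refine h2.of_nonneg_of_le (fun l => by positivity) fun l => ?_
  have h3 : ((1 : ℝ) + l) ^ t ≤ ((1 : ℝ) + l) ^ N := by
    rw [← Real.rpow_natCast]
    exact Real.rpow_le_rpow_of_exponent_le (by linarith [l.cast_nonneg (α := ℝ)]) hN
  calc r ^ l * ((1 : ℝ) + l) ^ t ≤ r ^ l * ((1 : ℝ) + l) ^ N := by gcongr
    _ = r⁻¹ * (((l + 1 : ℕ) : ℝ) ^ N * r ^ (l + 1)) := by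
      push_cast; field_simp; ring

/-- The forward substitution `v ↦ L⁻¹ v` preserves algebraic decay of order `s`. -/
theorem exists_bound_forward_substitution {δ γ : ℝ} {a b d : ℕ → ℝ} (hδ0 : 0 < δ) (hδγ : δ < γ)
    (ha : ∀ n, 2 ≤ n → |a n| ≤ δ * |b n|)
    (hd : ∀ n, γ * |b (n + 1)| * |d n| ≤ |d (n + 1)|) (hd0 : ∀ n, d n ≠ 0)
    {m : ℕ} (hm : 1 ≤ m) {sL C₁ C₂ : ℝ} (hsL : 0 < sL) (hC₁ : 0 < C₁) (hC₂ : 0 < C₂)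
    (hblow : ∀ k : ℕ, C₁ * ((m : ℝ) + k) ^ sL ≤ |b (k + 1)|)
    (hbup : ∀ k : ℕ, |b (k + 1)| ≤ C₂ * ((m : ℝ) + k) ^ sL)
    {s M : ℝ} (hs : 0 < s) (hM : 0 ≤ M) {v z : ℕ → ℝ}
    (hv : ∀ k : ℕ, |v k| ≤ M * ((m : ℝ) + k) ^ (-s))
    (hz : ∀ k, z k = v k + ∑ l ∈ Finset.Icc 1 k,
      (-1 : ℝ) ^ l * (∏ i ∈ Finset.range l, a (k + 1 - i)) * (d (k - l) / d k) * v (k - l)) :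
    ∃ K, 0 ≤ K ∧ ∀ k : ℕ, |z k| ≤ K * ((m : ℝ) + k) ^ (-s) := by
  have hγ0 : 0 < γ := hδ0.trans hδγ
  have hsum := summable_geometric_mul_rpow (div_pos hδ0 hγ0) ((div_lt_one hγ0).2 hδγ) (sL + s)
  have hm' : (1 : ℝ) ≤ m := by exact_mod_cast hm
  set f : ℕ → ℝ := fun l => (δ / γ) ^ l * ((1 : ℝ) + l) ^ (sL + s) with hf
  have hf0 : ∀ l, 0 ≤ f l := fun l => by positivity
  have hterm : ∀ j l : ℕ, |(-1 : ℝ) ^ l * (∏ i ∈ Finset.range l, a (j + l + 1 - i)) *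
      (d j / d (j + l)) * v j| ≤ f l * (C₂ / C₁ * M * ((m : ℝ) + (j + l : ℕ)) ^ (-s)) := by
    intro j l
    have hp := prod_lower_mul_minor_le hδ0.le hγ0.le ha hd j l
    have hdp : 0 < |d (j + l)| := abs_pos.2 (hd0 _)
    have hpj : 0 < (m : ℝ) + j := by positivity
    have hpk : 0 < (m : ℝ) + (j + l : ℕ) := by positivity
    have hbp : 0 < |b (j + 1)| := lt_of_lt_of_le (by positivity) (hblow j)
    rw [abs_mul, abs_mul, abs_mul, abs_pow, abs_neg, abs_one, one_pow, one_mul, abs_div,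
      Finset.abs_prod]
    have h1 : (∏ i ∈ Finset.range l, |a (j + l + 1 - i)|) * (|d j| / |d (j + l)|) ≤
        (δ / γ) ^ l * (|b (j + l + 1)| / |b (j + 1)|) := by
      rw [div_pow, div_mul_div_comm, ← mul_div_assoc, div_le_div_iff₀ hdp (by positivity)]
      linarith
    have h2 : |b (j + l + 1)| / |b (j + 1)| ≤
        C₂ * ((m : ℝ) + (j + l : ℕ)) ^ sL / (C₁ * ((m : ℝ) + j) ^ sL) := by
      gcongr
      · exact hbup _
      · exact hblow _
    have h3 : ((m : ℝ) + (j + l : ℕ)) / ((m : ℝ) + j) ≤ 1 + l := by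
      rw [div_le_iff₀ hpj]
      push_cast
      nlinarith [j.cast_nonneg (α := ℝ), l.cast_nonneg (α := ℝ),
        mul_nonneg (l.cast_nonneg (α := ℝ)) (j.cast_nonneg (α := ℝ))]
    calc _ ≤ (δ / γ) ^ l * (C₂ * ((m : ℝ) + (j + l : ℕ)) ^ sL / (C₁ * ((m : ℝ) + j) ^ sL)) *
          (M * ((m : ℝ) + j) ^ (-s)) := by
          refine mul_le_mul (h1.trans ?_) (hv j) (abs_nonneg _) (by positivity)
          gcongr
      _ = (δ / γ) ^ l * (((m : ℝ) + (j + l : ℕ)) / ((m : ℝ) + j)) ^ (sL + s) *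
          (C₂ / C₁ * M * ((m : ℝ) + (j + l : ℕ)) ^ (-s)) := by
          rw [Real.div_rpow hpk.le hpj.le, Real.rpow_add hpk, Real.rpow_add hpj,
            Real.rpow_neg hpk.le, Real.rpow_neg hpj.le]
          have := (Real.rpow_pos_of_pos hpk s).ne'
          have := (Real.rpow_pos_of_pos hpj s).ne'
          have := (Real.rpow_pos_of_pos hpj sL).ne'
          field_simp
      _ ≤ _ := by
          simp only [hf]
          gcongr
  have hF0 : 0 ≤ ∑' l, f l := tsum_nonneg hf0
  refine ⟨M + (∑' l, f l) * (C₂ / C₁ * M), by positivity, fun k => ?_⟩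
  rw [hz k, add_mul]
  refine (abs_add_le _ _).trans (add_le_add (hv k) ?_)
  refine (Finset.abs_sum_le_sum_abs _ _).trans ?_
  calc _ ≤ ∑ l ∈ Finset.Icc 1 k, f l * (C₂ / C₁ * M * ((m : ℝ) + k) ^ (-s)) := by
        refine Finset.sum_le_sum fun l hl => ?_
        obtain ⟨j, rfl⟩ := Nat.exists_eq_add_of_le' (Finset.mem_Icc.1 hl).2
        simpa only [Nat.add_sub_cancel] using hterm j l
    _ = (∑ l ∈ Finset.Icc 1 k, f l) * (C₂ / C₁ * M * ((m : ℝ) + k) ^ (-s)) := by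
        rw [Finset.sum_mul]
    _ ≤ (∑' l, f l) * (C₂ / C₁ * M * ((m : ℝ) + k) ^ (-s)) := by
        gcongr
        exact hsum.sum_le_tsum _ fun l _ => hf0 l
    _ = _ := by ring

/-- The backward substitution `z ↦ U⁻¹ z` converges absolutely and improves algebraic decay of
order `s` to order `s + sL`. -/
theorem exists_bound_Uinv {δ γ : ℝ} {b c d : ℕ → ℝ} (hδ0 : 0 < δ) (hδγ : δ < γ)
    (hc : ∀ n, 1 ≤ n → |c n| ≤ δ * |b n|)
    (hd : ∀ n, γ * |b (n + 1)| * |d n| ≤ |d (n + 1)|) (hd0 : ∀ n, d n ≠ 0)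
    {m : ℕ} (hm : 1 ≤ m) {sL C₁ : ℝ} (hsL : 0 < sL) (hC₁ : 0 < C₁)
    (hblow : ∀ k : ℕ, C₁ * ((m : ℝ) + k) ^ sL ≤ |b (k + 1)|)
    {s K : ℝ} (hs : 0 < s) (hK : 0 ≤ K) {z : ℕ → ℝ}
    (hz : ∀ k : ℕ, |z k| ≤ K * ((m : ℝ) + k) ^ (-s)) :
    (∀ k : ℕ, Summable fun l : ℕ => |Uterm c d z k (l + 1)|) ∧
    ∃ B, ∀ k : ℕ, |Uinv c d z k| ≤ B * ((m : ℝ) + k) ^ (-(s + sL)) := by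
  have hγ0 : 0 < γ := hδ0.trans hδγ
  have hm' : (1 : ℝ) ≤ m := by exact_mod_cast hm
  have hgeo : Summable fun l : ℕ => (δ / γ) ^ l :=
    summable_geometric_of_lt_one (by positivity) ((div_lt_one hγ0).2 hδγ)
  have hterm : ∀ k l : ℕ, |Uterm c d z k l| ≤
      (δ / γ) ^ l * (1 / (γ * C₁) * K * ((m : ℝ) + k) ^ (-(s + sL))) := by
    intro k l
    have hp := prod_upper_mul_minor_le hδ0.le hγ0.le hc hd k l
    have hdp : 0 < |d (k + l + 1)| := abs_pos.2 (hd0 _)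
    have hpk : 0 < (m : ℝ) + k := by positivity
    have hpl : 0 < (m : ℝ) + (k + l : ℕ) := by positivity
    have hbp : 0 < |b (k + l + 1)| := lt_of_lt_of_le (by positivity) (hblow (k + l))
    rw [Uterm, abs_mul, abs_mul, abs_mul, abs_pow, abs_neg, abs_one, one_pow, one_mul, abs_div,
      Finset.abs_prod]
    have h1 : |d k| / |d (k + l + 1)| * (∏ i ∈ Finset.range l, |c (k + 1 + i)|) ≤
        (δ / γ) ^ l * (1 / (γ * |b (k + l + 1)|)) := by
      rw [div_pow, div_mul_div_comm, div_mul_eq_mul_div, div_le_div_iff₀ hdp (by positivity)]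
      calc _ = ((∏ i ∈ Finset.range l, |c (k + 1 + i)|) * |d k| * γ ^ l) *
            (γ * |b (k + l + 1)|) := by ring
        _ ≤ (δ ^ l * |d (k + l)|) * (γ * |b (k + l + 1)|) := by gcongr
        _ = δ ^ l * (γ * |b (k + l + 1)| * |d (k + l)|) := by ring
        _ ≤ δ ^ l * |d (k + l + 1)| := by gcongr; exact hd _
        _ = _ := by ring
    calc _ ≤ (δ / γ) ^ l * (1 / (γ * (C₁ * ((m : ℝ) + (k + l : ℕ)) ^ sL))) *
          (K * ((m : ℝ) + (k + l : ℕ)) ^ (-s)) := by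
          refine mul_le_mul (h1.trans ?_) (hz _) (abs_nonneg _) (by positivity)
          gcongr
          exact hblow _
      _ = (δ / γ) ^ l * (1 / (γ * C₁) * K * ((m : ℝ) + (k + l : ℕ)) ^ (-(s + sL))) := by
          rw [Real.rpow_neg hpl.le, Real.rpow_neg hpl.le, Real.rpow_add hpl]
          field_simp
      _ ≤ _ := by
          have : ((m : ℝ) + (k + l : ℕ)) ^ (-(s + sL)) ≤ ((m : ℝ) + k) ^ (-(s + sL)) :=
            Real.rpow_le_rpow_of_nonpos hpk (by push_cast; linarith [l.cast_nonneg (α := ℝ)])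
              (by linarith)
          gcongr
  have hsum : ∀ k : ℕ, Summable fun l : ℕ => |Uterm c d z k l| := fun k =>
    (hgeo.mul_right _).of_nonneg_of_le (fun l => abs_nonneg _) (hterm k)
  refine ⟨fun k => (summable_nat_add_iff 1).2 (hsum k),
    (∑' l : ℕ, (δ / γ) ^ l) * (1 / (γ * C₁) * K), fun k => ?_⟩
  have hU : Uinv c d z k = ∑' l, Uterm c d z k l := by
    rw [(hsum k).of_abs.tsum_eq_zero_add, Uinv]
    simp [Uterm]
  rw [hU, mul_assoc, ← tsum_mul_right]
  have h1 : |∑' l, Uterm c d z k l| ≤ ∑' l, |Uterm c d z k l| := by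
    simpa only [Real.norm_eq_abs] using norm_tsum_le_tsum_norm (f := Uterm c d z k) (hsum k)
  refine h1.trans ?_
  simpa only [mul_assoc] using (hsum k).tsum_le_tsum (hterm k) (hgeo.mul_right _)

/-- STATEMENT 18: the approximate inverse `A` maps `Ω^s` into `Ω^{s+s_L}`: for
`y ∈ Ω^s` (`s > 1`), all the series occurring in the definition of `x = A y`
(namely those of `G y_I = U⁻¹(L⁻¹ y_I)` and of `w = G e₀`) converge absolutely, and
`sup_{k≥0} |x_k| ω_k^{s+s_L} < ∞`.  Here
`(x_0,…,x_{m−1})ᵀ = A_m y_F − β⋆ (G y_I)_0 · (column m−1 of A_m)` and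
`x_{m+k} = (G y_I)_k − λ⋆ ((row m−1 of A_m)·y_F) w_k
+ β⋆ λ⋆ (A_m)_{m−1,m−1} (G y_I)_0 w_k`. -/
theorem statement18 (δ : ℝ) (hδ0 : 0 < δ) (hδ1 : δ < 1 / 2)
    (a b c : ℕ → ℝ)
    (hb : ∀ n, 1 ≤ n → b n ≠ 0)
    (ha : ∀ n, 2 ≤ n → |a n| ≤ δ * |b n|)
    (hc : ∀ n, 1 ≤ n → |c n| ≤ δ * |b n|)
    (d : ℕ → ℝ)
    (hd0 : d 0 = 1) (hd1 : d 1 = b 1)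
    (hd : ∀ n : ℕ, d (n + 2) = b (n + 2) * d (n + 1) - a (n + 2) * c (n + 1) * d n)
    (γ θ η : ℝ) (hγ : γ = 1 / 2 + Real.sqrt (1 / 4 - δ ^ 2)) (hθ : θ = δ / γ)
    (hη : η = 1 / (γ * (1 - θ ^ 2)))
    (m : ℕ) (hm : 1 ≤ m) (sL C₁ C₂ : ℝ) (hsL : 0 < sL) (hC₁ : 0 < C₁) (hC₁₂ : C₁ ≤ C₂)
    (hblow : ∀ k : ℕ, C₁ * ((m : ℝ) + k) ^ sL ≤ |b (k + 1)|)
    (hbup : ∀ k : ℕ, |b (k + 1)| ≤ C₂ * ((m : ℝ) + k) ^ sL)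
    (A_m : Matrix (Fin m) (Fin m) ℝ) (lamS betaS : ℝ)
    (s : ℝ) (hs : 1 < s)
    (y : ℕ → ℝ) (hy : BddAbove (Set.range fun k => |y k| * wgt s k))
    -- `z = L⁻¹ y_I` where `y_I = (y_m, y_{m+1}, …)`
    (zy : ℕ → ℝ)
    (hzy0 : zy 0 = y m)
    (hzyk : ∀ k, 1 ≤ k → zy k = y (m + k) + ∑ l ∈ Finset.Icc 1 k,
      (-1 : ℝ) ^ l * (∏ i ∈ Finset.range l, a (k + 1 - i)) * (d (k - l) / d k) * y (m + (k - l)))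
    -- `z = L⁻¹ e₀`, used to define `w = G e₀ = U⁻¹ (L⁻¹ e₀)`
    (ze : ℕ → ℝ)
    (hze0 : ze 0 = e₀ 0)
    (hzek : ∀ k, 1 ≤ k → ze k = e₀ k + ∑ l ∈ Finset.Icc 1 k,
      (-1 : ℝ) ^ l * (∏ i ∈ Finset.range l, a (k + 1 - i)) * (d (k - l) / d k) * e₀ (k - l))
    -- `x = A y`
    (x : ℕ → ℝ)
    (hxF : ∀ i : Fin m, x i = (∑ j : Fin m, A_m i j * y j) -
      betaS * Uinv c d zy 0 * A_m i ⟨m - 1, by omega⟩)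
    (hxI : ∀ k : ℕ, x (m + k) = Uinv c d zy k -
      lamS * (∑ j : Fin m, A_m ⟨m - 1, by omega⟩ j * y j) * Uinv c d ze k +
      betaS * lamS * A_m ⟨m - 1, by omega⟩ ⟨m - 1, by omega⟩ * Uinv c d zy 0 *
        Uinv c d ze k) :
    (∀ k : ℕ, Summable (fun l : ℕ => |Uterm c d zy k (l + 1)|)) ∧
    (∀ k : ℕ, Summable (fun l : ℕ => |Uterm c d ze k (l + 1)|)) ∧
    BddAbove (Set.range fun k => |x k| * wgt (s + sL) k) := by
  have hq : 0 < 1 / 4 - δ ^ 2 := by nlinarith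
  have hsq := Real.sq_sqrt hq.le
  have hsq0 := Real.sqrt_pos.2 hq
  have hγ0 : 0 < γ := by linarith
  have hδγ : δ < γ := by linarith
  have hγ1 : γ ≤ 1 := by nlinarith
  have hγδ : γ - γ ^ 2 = δ ^ 2 := by rw [hγ]; linear_combination -hsq
  have hdl := minor_lower_bound hδ0.le hγ1 hγδ ha hc hd0 hd1 hd
  have hdne : ∀ n, d n ≠ 0 := by
    intro n
    induction n with
    | zero => simp [hd0]
    | succ n ih =>
      have := abs_pos.2 (hb (n + 1) (by omega))
      have := abs_pos.2 ih
      exact abs_pos.1 (lt_of_lt_of_le (by positivity) (hdl n))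
  have hC₂ : 0 < C₂ := hC₁.trans_le hC₁₂
  have hs0 : 0 < s := by linarith
  have hm0 : (0 : ℝ) < m := by exact_mod_cast hm
  have hwgt : ∀ t : ℝ, ∀ k : ℕ, wgt t (m + k) = ((m : ℝ) + k) ^ t := fun t k => by
    rw [wgt, if_neg (by omega)]; push_cast; rfl
  obtain ⟨M, hM⟩ := hy
  have hyM : ∀ k, |y k| * wgt s k ≤ M := fun k => hM ⟨k, rfl⟩
  have hM0 : 0 ≤ M := by
    have := hyM 0
    simp only [wgt, if_true, mul_one] at this
    exact (abs_nonneg _).trans this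
  have hv : ∀ k : ℕ, |y (m + k)| ≤ M * ((m : ℝ) + k) ^ (-s) := fun k => by
    have h := hyM (m + k)
    rw [hwgt] at h
    have hp : 0 < (m : ℝ) + k := by positivity
    rw [Real.rpow_neg hp.le, ← div_eq_mul_inv, le_div_iff₀ (by positivity)]
    exact h
  have he : ∀ k : ℕ, |e₀ k| ≤ (m : ℝ) ^ s * ((m : ℝ) + k) ^ (-s) := fun k => by
    rcases Nat.eq_zero_or_pos k with rfl | hk
    · simp [e₀, Real.rpow_neg hm0.le, (Real.rpow_pos_of_pos hm0 s).ne']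
    · rw [e₀, if_neg hk.ne', abs_zero]
      positivity
  obtain ⟨Ky, hKy0, hKy⟩ := exists_bound_forward_substitution hδ0 hδγ ha hdl hdne hm hsL hC₁ hC₂
    hblow hbup hs0 hM0 (v := fun k => y (m + k)) (z := zy) hv (fun k => by
      rcases Nat.eq_zero_or_pos k with rfl | hk
      · simpa using hzy0
      · exact hzyk k hk)
  obtain ⟨Ke, hKe0, hKe⟩ := exists_bound_forward_substitution hδ0 hδγ ha hdl hdne hm hsL hC₁ hC₂
    hblow hbup hs0 (by positivity) (v := e₀) (z := ze) he (fun k => by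
      rcases Nat.eq_zero_or_pos k with rfl | hk
      · simpa using hze0
      · exact hzek k hk)
  obtain ⟨hSy, By, hBy⟩ := exists_bound_Uinv hδ0 hδγ hc hdl hdne hm hsL hC₁ hblow hs0 hKy0 hKy
  obtain ⟨hSe, Be, hBe⟩ := exists_bound_Uinv hδ0 hδγ hc hdl hdne hm hsL hC₁ hblow hs0 hKe0 hKe
  refine ⟨hSy, hSe, ?_⟩
  obtain ⟨q, hxq⟩ : ∃ q : ℝ, ∀ k, x (m + k) = Uinv c d zy k + q * Uinv c d ze k :=
    ⟨_, fun k => (hxI k).trans (by rw [sub_add, sub_eq_add_neg, ← sub_mul, ← neg_mul])⟩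
  have hhead : BddAbove ((fun k => |x k| * wgt (s + sL) k) '' Set.Iio m) :=
    ((Set.finite_Iio m).image _).bddAbove
  obtain ⟨B, hB⟩ := hhead
  refine ⟨max B (By + |q| * Be), ?_⟩
  rintro _ ⟨k, rfl⟩
  rcases lt_or_ge k m with hk | hk
  · exact le_max_of_le_left (hB ⟨k, hk, rfl⟩)
  · obtain ⟨k, rfl⟩ := Nat.exists_eq_add_of_le hk
    refine le_max_of_le_right ?_
    have hp : 0 < (m : ℝ) + k := by positivity
    simp only [hwgt, hxq]
    rw [← le_div_iff₀ (by positivity), div_eq_mul_inv, ← Real.rpow_neg hp.le, add_mul, mul_assoc]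
    refine (abs_add_le _ _).trans (add_le_add (hBy k) ?_)
    rw [abs_mul]
    gcongr
    exact hBe k
end
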